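/- arXiv:1812.08078 — 3 statements merged into one kernel-verified Lean document; each statement's English description precedes it below -/
import Mathlib

section
/- For every α > 0 and every index i ∈ {1,…,n}, and for every measurable map T̂_i : ℝ^{p×n} → [−1,1], one has 𝔼_{π^α} 𝔼_{(θ,η)} |T̂_i(Y) − η_i| ≥ 𝔼_{π^α} 𝔼_{(θ,η)} |η**_i − η_i|, where the supervised learning oracle is η**_i = sign( Y_iᵀ ( Σ_{j ≠ i} η_j Y_j ) ), with sign(s) = 1 if s ≥ 0 and −1 otherwise, and Y_1,…,Y_n denote the columns of Y. -/
open MeasureTheory ProbabilityTheory Filter Finset Asymptotics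
open scoped ENNReal

noncomputable section

/-- Euclidean norm on `Fin p → ℝ`. -/
def eucNorm {p : ℕ} (θ : Fin p → ℝ) : ℝ := Real.sqrt (∑ i, θ i ^ 2)

/-- The set of label vectors in `{-1,1}^n`. -/
def pmOne (n : ℕ) : Set (Fin n → ℝ) := {η | ∀ i, η i = 1 ∨ η i = -1}

/-- `sgn s = 1` if `s ≥ 0` and `-1` otherwise. -/
def sgn (s : ℝ) : ℝ := if 0 ≤ s then 1 else -1

/-- Hamming-type loss `r(a,b) = min over ν ∈ {±1} of Σ_j |a_j - ν b_j|`. -/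
def lossR {n : ℕ} (a b : Fin n → ℝ) : ℝ :=
  min (∑ j, |a j - b j|) (∑ j, |a j + b j|)

/-- Law of `Y = θ ηᵀ + W`, where `W` has i.i.d. `N(0,σ²)` entries. -/
def lawY (p n : ℕ) (σ : ℝ) (θ : Fin p → ℝ) (η : Fin n → ℝ) :
    Measure (Fin p → Fin n → ℝ) :=
  Measure.pi fun i => Measure.pi fun j => gaussianReal (θ i * η j) (σ ^ 2).toNNReal

/-- Parameter set `Ω_Δ = {θ : ‖θ‖ ≥ Δ} × {-1,1}^n`. -/
def Omega (p n : ℕ) (Δ : ℝ) : Set ((Fin p → ℝ) × (Fin n → ℝ)) :=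
  {x | Δ ≤ eucNorm x.1 ∧ x.2 ∈ pmOne n}

/-- Expected loss of an estimator `f` at `(θ, η)`. -/
def risk (p n : ℕ) (σ : ℝ) (f : (Fin p → Fin n → ℝ) → Fin n → ℝ)
    (θ : Fin p → ℝ) (η : Fin n → ℝ) : ℝ :=
  ∫ y, lossR (f y) η ∂(lawY p n σ θ η)

/-- Minimax risk `Ψ_Δ`. -/
def minimaxRisk (p n : ℕ) (σ Δ : ℝ) : ℝ :=
  ⨅ f : {f : (Fin p → Fin n → ℝ) → Fin n → ℝ // Measurable f ∧ ∀ y, f y ∈ pmOne n},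
    ⨆ x : Omega p n Δ, (n : ℝ)⁻¹ * risk p n σ f.1 x.1.1 x.1.2

/-- Standard Gaussian upper tail `Φᶜ(t) = P(Z > t)`. -/
def Phic (t : ℝ) : ℝ := ((gaussianReal 0 1) {x | t < x}).toReal

/-- Signal-to-noise ratio `r_n = (Δ²/σ²)/√(Δ²/σ² + p/n)`. -/
def snr (p n : ℕ) (σ Δ : ℝ) : ℝ :=
  (Δ ^ 2 / σ ^ 2) / Real.sqrt (Δ ^ 2 / σ ^ 2 + (p : ℝ) / n)

/-- Gaussian product measure on `Fin p → ℝ` with i.i.d. centered coordinates of variance `v`. -/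
def gaussVec (p : ℕ) (v : ℝ) : Measure (Fin p → ℝ) :=
  Measure.pi fun _ => gaussianReal 0 v.toNNReal

/-- `G_σ(t, θ) = P((θ + σξ₁)ᵀ(θ + (σ/(n-1)) Σ_{j=2}^n ξ_j) ≤ ‖θ‖² t)` for i.i.d.
standard Gaussian vectors `ξ₁, …, ξ_n` in `ℝ^p`. -/
def Gfun (p n : ℕ) (σ t : ℝ) (θ : Fin p → ℝ) : ℝ :=
  (((gaussVec p 1).prod (Measure.pi fun _ : Fin (n - 1) => gaussVec p 1))
    {ξ | ∑ i, (θ i + σ * ξ.1 i) * (θ i + σ / ((n : ℝ) - 1) * ∑ j, ξ.2 j i)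
        ≤ eucNorm θ ^ 2 * t}).toReal

/-- Hollowed Gram matrix `H(YᵀY)` of the observation `y`, as a function. -/
def hollowGram {p n : ℕ} (y : Fin p → Fin n → ℝ) : Fin n → Fin n → ℝ :=
  fun a b => if a = b then 0 else ∑ i, y i a * y i b

/-- `v` is a unit-norm eigenvector of the matrix `M` for its largest eigenvalue. -/
def IsTopEigenvector {n : ℕ} (M : Fin n → Fin n → ℝ) (v : Fin n → ℝ) : Prop :=
  eucNorm v = 1 ∧ ∃ μ : ℝ, (∀ a, ∑ b, M a b * v b = μ * v a) ∧
    ∀ μ' : ℝ, (∃ w : Fin n → ℝ, w ≠ 0 ∧ ∀ a, ∑ b, M a b * w b = μ' * w a) → μ' ≤ μ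

/-- A spectral estimator: the entrywise sign of a measurable selection of a unit-norm
top eigenvector of `H(YᵀY)`. -/
def IsSpectralEstimator (p n : ℕ) (f : (Fin p → Fin n → ℝ) → Fin n → ℝ) : Prop :=
  Measurable f ∧ ∃ v : (Fin p → Fin n → ℝ) → Fin n → ℝ, Measurable v ∧
    (∀ y, IsTopEigenvector (hollowGram y) (v y)) ∧
    ∀ y a, f y a = sgn (v y a)

/-- Lloyd iterations `η̂^{k+1}(Y) = sign(H(YᵀY) η̂^k(Y))`, started from `f0`. -/
def lloydIter {p n : ℕ} (f0 : (Fin p → Fin n → ℝ) → Fin n → ℝ) :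
    ℕ → (Fin p → Fin n → ℝ) → Fin n → ℝ
  | 0 => f0
  | k + 1 => fun y a => sgn (∑ b, hollowGram y a b * lloydIter f0 k y b)

/-- Operator (spectral) norm of a real matrix with respect to Euclidean norms. -/
def opNorm {m n : ℕ} (M : Matrix (Fin m) (Fin n) ℝ) : ℝ :=
  ‖LinearMap.toContinuousLinearMap (Matrix.toEuclideanLin M)‖

/-- `H(M)`: the matrix `M` with its diagonal entries replaced by zero. -/
def hollow {n : ℕ} (M : Matrix (Fin n) (Fin n) ℝ) : Matrix (Fin n) (Fin n) ℝ :=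
  Matrix.of fun a b => if a = b then 0 else M a b

/-- Gram matrix `WᵀW` of a `p × n` array `w`. -/
def gramMat {p n : ℕ} (w : Fin p → Fin n → ℝ) : Matrix (Fin n) (Fin n) ℝ :=
  Matrix.of fun a b => ∑ i, w i a * w i b

/-- Law of a `p × n` random matrix with i.i.d. `N(0, τ²)` entries. -/
def lawW (p n : ℕ) (τ : ℝ) : Measure (Fin p → Fin n → ℝ) :=
  Measure.pi fun _ => Measure.pi fun _ => gaussianReal 0 (τ ^ 2).toNNReal

/-- Rademacher (uniform ±1) measure on `ℝ`. -/
def rademacher : Measure ℝ :=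
  (2 : ℝ≥0∞)⁻¹ • Measure.dirac (1 : ℝ) + (2 : ℝ≥0∞)⁻¹ • Measure.dirac (-1 : ℝ)

instance : IsProbabilityMeasure rademacher := by
  constructor
  simp [rademacher, Measure.add_apply, Measure.smul_apply, smul_eq_mul]
  rw [ENNReal.inv_two_add_inv_two]

/-- i.i.d. Rademacher vector measure on `Fin n → ℝ`. -/
def radVec (n : ℕ) : Measure (Fin n → ℝ) := Measure.pi fun _ => rademacher


lemma pi_withDensity_ofReal {ι : Type*} [Fintype ι] {E : ι → Type*}
    [∀ i, MeasurableSpace (E i)] (μ : ∀ i, Measure (E i)) [∀ i, SigmaFinite (μ i)]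
    (f : ∀ i, E i → ℝ) (hf : ∀ i, Integrable (f i) (μ i)) (hf0 : ∀ i x, 0 ≤ f i x)
    (ν : ∀ i, Measure (E i)) [∀ i, SigmaFinite (ν i)]
    (hν : ∀ i, ν i = (μ i).withDensity (fun x => ENNReal.ofReal (f i x))) :
    Measure.pi ν = (Measure.pi μ).withDensity (fun x => ENNReal.ofReal (∏ i, f i (x i))) := by
  refine Measure.pi_eq fun s hs => ?_
  rw [withDensity_apply _ (MeasurableSet.univ_pi hs), Measure.restrict_pi_pi,
    ← ofReal_integral_eq_lintegral_ofReal, integral_fintype_prod_eq_prod, ENNReal.ofReal_prod_of_nonneg]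
  · refine Finset.prod_congr rfl fun i _ => ?_
    rw [hν, withDensity_apply _ (hs i), ← ofReal_integral_eq_lintegral_ofReal]
    · exact (hf i).integrableOn
    · exact ae_of_all _ (hf0 i)
  · exact fun i _ => integral_nonneg (hf0 i)
  · exact Integrable.fintype_prod_dep fun i => (hf i).integrableOn
  · exact ae_of_all _ fun x => Finset.prod_nonneg fun i _ => hf0 i _

/-- Joint density of `Y`. -/
def ydens (p n : ℕ) (σ : ℝ) (θ : Fin p → ℝ) (η : Fin n → ℝ) (y : Fin p → Fin n → ℝ) : ℝ :=
  ∏ k, ∏ j, gaussianPDFReal (θ k * η j) (σ ^ 2).toNNReal (y k j)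

lemma dens_nonneg (p n : ℕ) (σ : ℝ) (θ : Fin p → ℝ) (η : Fin n → ℝ) (y : Fin p → Fin n → ℝ) :
    0 ≤ ydens p n σ θ η y :=
  Finset.prod_nonneg fun _ _ => Finset.prod_nonneg fun _ _ => gaussianPDFReal_nonneg _ _ _

lemma measurable_dens (p n : ℕ) (σ : ℝ) :
    Measurable fun q : ((Fin p → ℝ) × (Fin n → ℝ)) × (Fin p → Fin n → ℝ) =>
      ydens p n σ q.1.1 q.1.2 q.2 := by
  unfold ydens gaussianPDFReal
  fun_prop

/-- Density of a row of `Y`. -/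
def rdens (n : ℕ) (σ : ℝ) (t : ℝ) (η : Fin n → ℝ) (z : Fin n → ℝ) : ℝ :=
  ∏ j, gaussianPDFReal (t * η j) (σ ^ 2).toNNReal (z j)

lemma integrable_rdens (n : ℕ) (σ : ℝ) (t : ℝ) (η : Fin n → ℝ) :
    Integrable (rdens n σ t η) := by
  have h := Integrable.fintype_prod (ι := Fin n) (E := ℝ) (μ := fun _ => volume)
    (f := fun j => gaussianPDFReal (t * η j) (σ ^ 2).toNNReal)
    (fun j => integrable_gaussianPDFReal _ _)
  rw [← volume_pi] at h
  exact h

lemma rdens_nonneg (n : ℕ) (σ : ℝ) (t : ℝ) (η : Fin n → ℝ) (z : Fin n → ℝ) :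
    0 ≤ rdens n σ t η z :=
  Finset.prod_nonneg fun _ _ => gaussianPDFReal_nonneg _ _ _

lemma ydens_eq (p n : ℕ) (σ : ℝ) (θ : Fin p → ℝ) (η : Fin n → ℝ) :
    ydens p n σ θ η = fun y => ∏ k, rdens n σ (θ k) η (y k) := rfl

lemma integrable_dens (p n : ℕ) (σ : ℝ) (θ : Fin p → ℝ) (η : Fin n → ℝ) :
    Integrable (ydens p n σ θ η) := by
  have h := Integrable.fintype_prod (ι := Fin p) (E := Fin n → ℝ) (μ := fun _ => volume)
    (f := fun k => rdens n σ (θ k) η) (fun k => integrable_rdens _ _ _ _)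
  rw [← volume_pi] at h
  rw [ydens_eq]
  exact h

lemma rowLaw_eq (n : ℕ) (σ : ℝ) (hσ : 0 < σ) (t : ℝ) (η : Fin n → ℝ) :
    (Measure.pi fun j => gaussianReal (t * η j) (σ ^ 2).toNNReal) =
      volume.withDensity (fun z => ENNReal.ofReal (rdens n σ t η z)) := by
  have hv : (σ ^ 2).toNNReal ≠ 0 := by simp; positivity
  have h := pi_withDensity_ofReal (ι := Fin n) (E := fun _ => ℝ) (fun _ => volume)
    (fun j => gaussianPDFReal (t * η j) (σ ^ 2).toNNReal)
    (fun j => integrable_gaussianPDFReal _ _) (fun k z => gaussianPDFReal_nonneg _ _ _)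
    (fun j => gaussianReal (t * η j) (σ ^ 2).toNNReal)
    (fun j => by rw [gaussianReal_of_var_ne_zero _ hv]; rfl)
  rw [← volume_pi] at h
  exact h

lemma lawY_eq (p n : ℕ) (σ : ℝ) (hσ : 0 < σ) (θ : Fin p → ℝ) (η : Fin n → ℝ) :
    lawY p n σ θ η = volume.withDensity (fun y => ENNReal.ofReal (ydens p n σ θ η y)) := by
  have h := pi_withDensity_ofReal (ι := Fin p) (E := fun _ => Fin n → ℝ) (fun _ => volume)
    (fun k => rdens n σ (θ k) η)
    (fun k => integrable_rdens _ _ _ _) (fun k z => rdens_nonneg _ _ _ _ _)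
    (fun k => Measure.pi fun j => gaussianReal (θ k * η j) (σ ^ 2).toNNReal)
    (fun k => rowLaw_eq n σ hσ (θ k) η)
  rw [← volume_pi] at h
  rw [ydens_eq]
  exact h

instance (p n : ℕ) (σ : ℝ) (θ : Fin p → ℝ) (η : Fin n → ℝ) :
    IsProbabilityMeasure (lawY p n σ θ η) := by unfold lawY; infer_instance

instance (p : ℕ) (v : ℝ) : IsProbabilityMeasure (gaussVec p v) := by
  unfold gaussVec; infer_instance

instance (n : ℕ) : IsProbabilityMeasure (radVec n) := by
  unfold radVec; infer_instance

lemma integral_lawY (p n : ℕ) (σ : ℝ) (hσ : 0 < σ) (θ : Fin p → ℝ) (η : Fin n → ℝ)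
    (f : (Fin p → Fin n → ℝ) → ℝ) :
    ∫ y, f y ∂(lawY p n σ θ η) = ∫ y, ydens p n σ θ η y * f y := by
  have hm : Measurable (ydens p n σ θ η) :=
    Measurable.comp (g := fun q : ((Fin p → ℝ) × (Fin n → ℝ)) × (Fin p → Fin n → ℝ) =>
      ydens p n σ q.1.1 q.1.2 q.2) (f := fun y => ((θ, η), y)) (measurable_dens p n σ)
      (measurable_const.prodMk measurable_id)
  rw [lawY_eq p n σ hσ, integral_withDensity_eq_integral_toReal_smul]
  · simp [ENNReal.toReal_ofReal, dens_nonneg]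
  · exact hm.ennreal_ofReal
  · simp

lemma integral_dens (p n : ℕ) (σ : ℝ) (hσ : 0 < σ) (θ : Fin p → ℝ) (η : Fin n → ℝ) :
    ∫ y, ydens p n σ θ η y = 1 := by
  have := integral_lawY p n σ hσ θ η (fun _ => 1)
  simpa using this.symm

lemma ae_radVec (n : ℕ) (i : Fin n) : ∀ᵐ η ∂(radVec n), η i = 1 ∨ η i = -1 := by
  have h : ∀ᵐ x ∂rademacher, x = 1 ∨ x = -1 := by
    have hs : MeasurableSet {x : ℝ | x = 1 ∨ x = -1} :=
      (measurableSet_singleton (1 : ℝ)).union (measurableSet_singleton (-1 : ℝ))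
    unfold rademacher
    rw [ae_add_measure_iff]
    constructor <;> refine Measure.ae_smul_measure ?_ _ <;> rw [ae_dirac_iff hs] <;> simp
  exact (Measure.quasiMeasurePreserving_eval (fun _ : Fin n => rademacher) i).ae h

/-- Flip coordinate `i`. -/
def flipC {n : ℕ} (i : Fin n) (η : Fin n → ℝ) : Fin n → ℝ :=
  fun j => if j = i then - η j else η j

lemma mp_flip (n : ℕ) (i : Fin n) : MeasurePreserving (flipC i) (radVec n) (radVec n) := by
  have : ∀ j, MeasurePreserving (fun x : ℝ => if j = i then -x else x) rademacher rademacher := by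
    intro j
    by_cases h : j = i
    · simp only [h, if_true]
      refine ⟨measurable_neg, ?_⟩
      unfold rademacher
      rw [Measure.map_add _ _ measurable_neg, Measure.map_smul, Measure.map_smul,
        Measure.map_dirac' measurable_neg, Measure.map_dirac' measurable_neg, neg_neg, add_comm]
    · simp only [h, if_false]
      exact MeasurePreserving.id _
  exact measurePreserving_pi _ _ this

/-- Marginal density of `Y` given `η`. -/
def marg (p n : ℕ) (σ α : ℝ) (η : Fin n → ℝ) (y : Fin p → Fin n → ℝ) : ℝ :=
  ∫ θ, ydens p n σ θ η y ∂(gaussVec p (α ^ 2))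

lemma row_integral (n : ℕ) (σ α : ℝ) (hσ : 0 < σ) (hα : 0 < α) (η z : Fin n → ℝ) :
    ∫ t, (∏ j, gaussianPDFReal (t * η j) (σ ^ 2).toNNReal (z j))
        ∂(gaussianReal 0 (α ^ 2).toNNReal) =
      (((√(2 * Real.pi * σ ^ 2))⁻¹) ^ n * (√(2 * Real.pi * α ^ 2))⁻¹ *
        Real.exp (- (∑ j, z j ^ 2) / (2 * σ ^ 2)) *
        ∫ t : ℝ, Real.exp (-(((∑ j, η j ^ 2) / σ ^ 2 + 1 / α ^ 2) / 2) * t ^ 2)) *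
        Real.exp ((∑ j, η j * z j) ^ 2 / (2 * σ ^ 4 * ((∑ j, η j ^ 2) / σ ^ 2 + 1 / α ^ 2))) := by
  have hv : (α ^ 2).toNNReal ≠ 0 := by simp; positivity
  rw [integral_gaussianReal_eq_integral_smul hv]
  set b := (∑ j, η j ^ 2) / σ ^ 2 + 1 / α ^ 2 with hb
  have hN : 0 ≤ ∑ j, η j ^ 2 := Finset.sum_nonneg fun _ _ => sq_nonneg _
  have hbpos : 0 < b := by positivity
  set S := ∑ j, η j * z j with hS
  rw [← integral_sub_right_eq_self (fun t : ℝ => Real.exp (-(b / 2) * t ^ 2)) (S / (σ ^ 2 * b)),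
    ← integral_const_mul, ← integral_mul_const]
  congr 1
  ext t
  simp only [gaussianPDFReal, smul_eq_mul, Real.coe_toNNReal _ (sq_nonneg σ),
    Real.coe_toNNReal _ (sq_nonneg α), Finset.prod_mul_distrib, Finset.prod_const,
    Finset.card_univ, Fintype.card_fin, ← Real.exp_sum]
  have e1 : ∑ j, -(z j - t * η j) ^ 2 / (2 * σ ^ 2) =
      - (∑ j, z j ^ 2) / (2 * σ ^ 2) + t * S / σ ^ 2 - t ^ 2 * (∑ j, η j ^ 2) / (2 * σ ^ 2) := by
    rw [hS, ← Finset.sum_div, ← Finset.sum_neg_distrib, Finset.mul_sum, Finset.mul_sum]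
    field_simp
    rw [Finset.mul_sum, ← Finset.sum_add_distrib, ← Finset.sum_sub_distrib]
    refine Finset.sum_congr rfl fun j _ => ?_
    ring
  rw [e1]
  have e2 : - (∑ j, z j ^ 2) / (2 * σ ^ 2) + t * S / σ ^ 2 - t ^ 2 * (∑ j, η j ^ 2) / (2 * σ ^ 2)
      + -(t - 0) ^ 2 / (2 * α ^ 2) = - (∑ j, z j ^ 2) / (2 * σ ^ 2) +
      -(b / 2) * (t - S / (σ ^ 2 * b)) ^ 2 + S ^ 2 / (2 * σ ^ 4 * b) := by
    have : -(b / 2) * (t - S / (σ ^ 2 * b)) ^ 2 + S ^ 2 / (2 * σ ^ 4 * b) =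
        - (b / 2) * t ^ 2 + t * S / σ ^ 2 := by
      field_simp
      ring
    rw [add_assoc, this, hb]
    field_simp
    ring
  have e3 := congrArg Real.exp e2
  rw [Real.exp_add, Real.exp_add, Real.exp_add] at e3
  linear_combination ((√(2 * Real.pi * σ ^ 2))⁻¹) ^ n * (√(2 * Real.pi * α ^ 2))⁻¹ * e3

lemma marg_eq (p n : ℕ) (σ α : ℝ) (hσ : 0 < σ) (hα : 0 < α) :
    ∃ (K : ℝ → (Fin p → Fin n → ℝ) → ℝ) (c : ℝ → ℝ), (∀ N y, 0 ≤ K N y) ∧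
      (∀ N, 0 ≤ N → 0 ≤ c N) ∧
      ∀ η y, marg p n σ α η y = K (∑ j, η j ^ 2) y *
        Real.exp (c (∑ j, η j ^ 2) * ∑ k, (∑ j, η j * y k j) ^ 2) := by
  refine ⟨fun N y => ∏ k, (((√(2 * Real.pi * σ ^ 2))⁻¹) ^ n * (√(2 * Real.pi * α ^ 2))⁻¹ *
        Real.exp (- (∑ j, y k j ^ 2) / (2 * σ ^ 2)) *
        ∫ t : ℝ, Real.exp (-((N / σ ^ 2 + 1 / α ^ 2) / 2) * t ^ 2)),
    fun N => 1 / (2 * σ ^ 4 * (N / σ ^ 2 + 1 / α ^ 2)), ?_, ?_, ?_⟩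
  · intro N y
    refine Finset.prod_nonneg fun k _ => mul_nonneg (by positivity) ?_
    exact integral_nonneg fun t => (Real.exp_pos _).le
  · intro N hN; positivity
  · intro η y
    unfold marg ydens gaussVec
    rw [integral_fintype_prod_eq_prod
      (fun k t => ∏ j, gaussianPDFReal (t * η j) (σ ^ 2).toNNReal (y k j))]
    simp_rw [row_integral n σ α hσ hα]
    rw [Finset.prod_mul_distrib, ← Real.exp_sum, Finset.mul_sum]
    congr 2
    refine Finset.sum_congr rfl fun k _ => ?_
    ring

lemma marg_nonneg (p n : ℕ) (σ α : ℝ) (η : Fin n → ℝ) (y : Fin p → Fin n → ℝ) :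
    0 ≤ marg p n σ α η y := integral_nonneg fun _ => dens_nonneg _ _ _ _ _ _

/-- The comparison of the marginal densities. -/
lemma marg_compare (p n : ℕ) (σ α : ℝ) (hσ : 0 < σ) (hα : 0 < α) (i : Fin n) (η : Fin n → ℝ)
    (y : Fin p → Fin n → ℝ) :
    (0 ≤ η i * ∑ k, y k i * ∑ j ∈ Finset.univ.erase i, η j * y k j →
      marg p n σ α (flipC i η) y ≤ marg p n σ α η y) ∧
    (η i * ∑ k, y k i * ∑ j ∈ Finset.univ.erase i, η j * y k j ≤ 0 →
      marg p n σ α η y ≤ marg p n σ α (flipC i η) y) := by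
  obtain ⟨K, c, hK, hc, h⟩ := marg_eq p n σ α hσ hα
  have hN : ∑ j, flipC i η j ^ 2 = ∑ j, η j ^ 2 := by
    refine Finset.sum_congr rfl fun j _ => ?_
    unfold flipC; split_ifs <;> ring
  have hc' := hc (∑ j, η j ^ 2) (Finset.sum_nonneg fun _ _ => sq_nonneg _)
  have hd : ∑ k, (∑ j, η j * y k j) ^ 2 - ∑ k, (∑ j, flipC i η j * y k j) ^ 2 =
      4 * (η i * ∑ k, y k i * ∑ j ∈ Finset.univ.erase i, η j * y k j) := by
    rw [← Finset.sum_sub_distrib, Finset.mul_sum, Finset.mul_sum]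
    refine Finset.sum_congr rfl fun k _ => ?_
    rw [← Finset.add_sum_erase _ (fun j => η j * y k j) (Finset.mem_univ i),
      ← Finset.add_sum_erase _ (fun j => flipC i η j * y k j) (Finset.mem_univ i)]
    have : ∑ j ∈ Finset.univ.erase i, flipC i η j * y k j =
        ∑ j ∈ Finset.univ.erase i, η j * y k j := by
      refine Finset.sum_congr rfl fun j hj => ?_
      simp [flipC, Finset.ne_of_mem_erase hj]
    rw [this]
    simp only [flipC, if_true]
    ring
  rw [h, h, hN]
  constructor
  · intro h0
    refine mul_le_mul_of_nonneg_left (Real.exp_le_exp.2 (mul_le_mul_of_nonneg_left ?_ hc')) (hK _ _)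
    linarith
  · intro h0
    refine mul_le_mul_of_nonneg_left (Real.exp_le_exp.2 (mul_le_mul_of_nonneg_left ?_ hc')) (hK _ _)
    linarith

lemma integrable_dens_prod (p n : ℕ) (σ α : ℝ) (hσ : 0 < σ) (η : Fin n → ℝ) :
    Integrable (fun q : (Fin p → ℝ) × (Fin p → Fin n → ℝ) => ydens p n σ q.1 η q.2)
      ((gaussVec p (α ^ 2)).prod volume) := by
  have hg : Measurable (fun q : (Fin p → ℝ) × (Fin p → Fin n → ℝ) => ((q.1, η), q.2)) :=
    (measurable_fst.prodMk measurable_const).prodMk measurable_snd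
  have hm : Measurable (fun q : (Fin p → ℝ) × (Fin p → Fin n → ℝ) => ydens p n σ q.1 η q.2) := by
    have h := (measurable_dens p n σ).comp hg
    simp only [Function.comp_def] at h
    exact h
  rw [integrable_prod_iff hm.aestronglyMeasurable]
  refine ⟨ae_of_all _ fun θ => integrable_dens p n σ θ η, ?_⟩
  simp [Real.norm_of_nonneg (dens_nonneg _ _ _ _ _ _), integral_dens p n σ hσ]

lemma integrable_marg (p n : ℕ) (σ α : ℝ) (hσ : 0 < σ) (η : Fin n → ℝ) :
    Integrable (marg p n σ α η) :=
  (integrable_dens_prod p n σ α hσ η).integral_prod_right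

lemma risk_eq (p n : ℕ) (σ α : ℝ) (hσ : 0 < σ) (i : Fin n)
    (φ : (Fin n → ℝ) → (Fin p → Fin n → ℝ) → ℝ)
    (hφ : Measurable fun q : (Fin n → ℝ) × (Fin p → Fin n → ℝ) => φ q.1 q.2)
    (hb : ∀ η y, |φ η y| ≤ 1 + |η i|) :
    Integrable (fun η => ∫ y, φ η y * marg p n σ α η y) (radVec n) ∧
    ∫ θ, ∫ η, (∫ y, φ η y ∂(lawY p n σ θ η)) ∂(radVec n) ∂(gaussVec p (α ^ 2)) =
      ∫ η, (∫ y, φ η y * marg p n σ α η y) ∂(radVec n) := by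
  have hmeas : StronglyMeasurable (fun q : (Fin p → ℝ) × (Fin n → ℝ) =>
      ∫ y, φ q.2 y ∂(lawY p n σ q.1 q.2)) := by
    simp_rw [integral_lawY p n σ hσ]
    refine StronglyMeasurable.integral_prod_right'
      (f := fun q : ((Fin p → ℝ) × (Fin n → ℝ)) × (Fin p → Fin n → ℝ) =>
        ydens p n σ q.1.1 q.1.2 q.2 * φ q.1.2 q.2) ?_
    refine ((measurable_dens p n σ).mul ?_).stronglyMeasurable
    exact hφ.comp ((measurable_snd.comp measurable_fst).prodMk measurable_snd)
  have hB : Integrable (fun η : Fin n → ℝ => 1 + |η i|) (radVec n) := by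
    refine Integrable.of_bound (C := 2)
      (show Measurable fun η : Fin n → ℝ => 1 + |η i| by fun_prop).aestronglyMeasurable ?_
    filter_upwards [ae_radVec n i] with η hη
    rcases hη with h | h <;> simp [h] <;> norm_num
  have hint : Integrable (fun q : (Fin p → ℝ) × (Fin n → ℝ) =>
      ∫ y, φ q.2 y ∂(lawY p n σ q.1 q.2)) ((gaussVec p (α ^ 2)).prod (radVec n)) := by
    refine Integrable.mono' (hB.comp_snd (gaussVec p (α ^ 2))) hmeas.aestronglyMeasurable ?_
    refine ae_of_all _ fun q => ?_
    refine (norm_integral_le_of_norm_le_const (C := 1 + |q.2 i|) (ae_of_all _ fun y => ?_)).trans ?_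
    · exact hb _ _
    · simp
  have key : ∀ η, ∫ θ, (∫ y, φ η y ∂(lawY p n σ θ η)) ∂(gaussVec p (α ^ 2)) =
      ∫ y, φ η y * marg p n σ α η y := by
    intro η
    simp_rw [integral_lawY p n σ hσ]
    rw [integral_integral_swap]
    · congr 1; ext y
      rw [integral_mul_const, mul_comm]; rfl
    · refine (integrable_dens_prod p n σ α hσ η).mul_bdd (c := 1 + |η i|) ?_ ?_
      · exact (hφ.comp (measurable_const.prodMk measurable_snd)).aestronglyMeasurable
      · exact ae_of_all _ fun q => hb _ _
  refine ⟨?_, ?_⟩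
  · have := hint.integral_prod_right
    simpa only [key] using this
  · rw [integral_integral_swap hint]
    simp only [key]

lemma sgn_abs (s : ℝ) : |sgn s| ≤ 1 := by unfold sgn; split_ifs <;> simp

lemma measurable_sgn : Measurable sgn :=
  Measurable.ite measurableSet_Ici measurable_const measurable_const

lemma flip_sum {p n : ℕ} (i : Fin n) (η : Fin n → ℝ) (y : Fin p → Fin n → ℝ) :
    ∑ k, y k i * ∑ j ∈ Finset.univ.erase i, flipC i η j * y k j =
      ∑ k, y k i * ∑ j ∈ Finset.univ.erase i, η j * y k j := by
  refine Finset.sum_congr rfl fun k _ => ?_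
  congr 1
  refine Finset.sum_congr rfl fun j hj => ?_
  simp [flipC, Finset.ne_of_mem_erase hj]

/-- Proposition 2: optimality of the supervised learning oracle under the prior `π^α`. -/
theorem statement2 (n p : ℕ) (hn : 2 ≤ n) (hp : 1 ≤ p) (σ α : ℝ) (hσ : 0 < σ) (hα : 0 < α)
    (i : Fin n) (T : (Fin p → Fin n → ℝ) → ℝ) (hT : Measurable T)
    (hT1 : ∀ y, T y ∈ Set.Icc (-1 : ℝ) 1) :
    ∫ θ, ∫ η, (∫ y,
        |sgn (∑ k, y k i * ∑ j ∈ Finset.univ.erase i, η j * y k j) - η i|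
        ∂(lawY p n σ θ η)) ∂(radVec n) ∂(gaussVec p (α ^ 2))
      ≤ ∫ θ, ∫ η, (∫ y, |T y - η i| ∂(lawY p n σ θ η)) ∂(radVec n) ∂(gaussVec p (α ^ 2)) := by
  have hbT : ∀ (η : Fin n → ℝ) (y : Fin p → Fin n → ℝ), |(|T y - η i|)| ≤ 1 + |η i| := by
    intro η y
    rw [abs_abs]
    have := abs_le.2 (hT1 y)
    exact (abs_sub _ _).trans (by linarith)
  have hbS : ∀ (η : Fin n → ℝ) (y : Fin p → Fin n → ℝ),
      |(|sgn (∑ k, y k i * ∑ j ∈ Finset.univ.erase i, η j * y k j) - η i|)| ≤ 1 + |η i| := by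
    intro η y
    rw [abs_abs]
    have := sgn_abs (∑ k, y k i * ∑ j ∈ Finset.univ.erase i, η j * y k j)
    exact (abs_sub _ _).trans (by linarith)
  have hmT : Measurable fun q : (Fin n → ℝ) × (Fin p → Fin n → ℝ) => |T q.2 - q.1 i| := by
    fun_prop
  have hmS : Measurable fun q : (Fin n → ℝ) × (Fin p → Fin n → ℝ) =>
      |sgn (∑ k, q.2 k i * ∑ j ∈ Finset.univ.erase i, q.1 j * q.2 k j) - q.1 i| := by
    have := measurable_sgn
    fun_prop
  obtain ⟨iS, eS⟩ := risk_eq p n σ α hσ i _ hmS hbS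
  obtain ⟨iT, eT⟩ := risk_eq p n σ α hσ i _ hmT hbT
  rw [eS, eT]
  have hmp := mp_flip n i
  have dbl : ∀ F : (Fin n → ℝ) → ℝ, Integrable F (radVec n) →
      Integrable (fun η => F η + F (flipC i η)) (radVec n) ∧
      2 * ∫ η, F η ∂(radVec n) = ∫ η, (F η + F (flipC i η)) ∂(radVec n) := by
    intro F hF
    have h1 : Integrable (fun η => F (flipC i η)) (radVec n) := hmp.integrable_comp_of_integrable hF
    refine ⟨hF.add h1, ?_⟩
    rw [integral_add hF h1]
    have : ∫ η, F (flipC i η) ∂(radVec n) = ∫ η, F η ∂(radVec n) := by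
      have h2 := integral_map (μ := radVec n) hmp.measurable.aemeasurable (f := F)
        (by rw [hmp.map_eq]; exact hF.aestronglyMeasurable)
      rw [hmp.map_eq] at h2
      exact h2.symm
    rw [this]; ring
  obtain ⟨jS, dS⟩ := dbl _ iS
  obtain ⟨jT, dT⟩ := dbl _ iT
  suffices h : ∀ᵐ η ∂(radVec n), _ from by
    have := integral_mono_ae jS jT h
    linarith
  filter_upwards [ae_radVec n i] with η hη
  have hI : ∀ (ψ : (Fin n → ℝ) → (Fin p → Fin n → ℝ) → ℝ),
      (Measurable fun q : (Fin n → ℝ) × (Fin p → Fin n → ℝ) => ψ q.1 q.2) →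
      (∀ η y, |ψ η y| ≤ 1 + |η i|) → ∀ ζ, Integrable (fun y => ψ ζ y * marg p n σ α ζ y) := by
    intro ψ h1 h2 ζ
    refine (integrable_marg p n σ α hσ ζ).bdd_mul (c := 1 + |ζ i|) ?_ ?_
    · exact (h1.comp (measurable_const.prodMk measurable_id)).aestronglyMeasurable
    · exact ae_of_all _ fun q => h2 _ _
  have iS1 := hI _ hmS hbS η
  have iS2 := hI _ hmS hbS (flipC i η)
  have iT1 := hI _ hmT hbT η
  have iT2 := hI _ hmT hbT (flipC i η)
  rw [← integral_add iS1 iS2, ← integral_add iT1 iT2]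
  refine integral_mono (iS1.add iS2) (iT1.add iT2) fun y => ?_
  obtain ⟨c1, c2⟩ := marg_compare p n σ α hσ hα i η y
  have m1 := marg_nonneg p n σ α η y
  have m2 := marg_nonneg p n σ α (flipC i η) y
  have hf : flipC i η i = - η i := by simp [flipC]
  simp only [flip_sum, hf]
  obtain ⟨t1, t2⟩ := hT1 y
  have a1 : |T y - 1| = 1 - T y := by rw [abs_of_nonpos] <;> linarith
  have a2 : |T y + 1| = 1 + T y := by rw [abs_of_nonneg] <;> linarith
  rcases hη with h | h <;> simp only [h, one_mul, neg_mul, neg_neg, sub_neg_eq_add] at c1 c2 ⊢ <;>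
    rw [a1, a2] <;> unfold sgn <;> split_ifs with hs
  · have := c1 hs
    norm_num
    nlinarith
  · have := c2 (not_le.1 hs).le
    norm_num
    nlinarith
  · have := c2 (by linarith)
    norm_num
    nlinarith
  · have := c1 (by linarith)
    norm_num
    nlinarith

end
end

section
/- There exists an absolute constant c > 0 such that for every Δ > 0 and every α > 0, Ψ_Δ ≥ c · 𝔼_{π^α_θ}[ G_σ(0, θ) ] − c · P( Σ_{j=1}^p ε_j² ≤ Δ²/α² ), where ε_1,…,ε_p are i.i.d. standard Gaussian random variables. -/
open MeasureTheory ProbabilityTheory Filter Finset Asymptotics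
open scoped ENNReal

noncomputable section

/-! ### Generic facts on product measures -/

lemma aux_lintegral_pi_prod {X : Type*} [MeasurableSpace X] {n : ℕ} (μ : Fin n → Measure X)
    [∀ i, SigmaFinite (μ i)] (f : Fin n → X → ℝ≥0∞) (hf : ∀ i, Measurable (f i)) :
    ∫⁻ x, ∏ i, f i (x i) ∂(Measure.pi μ) = ∏ i, ∫⁻ x, f i x ∂(μ i) := by
  induction n with
  | zero => simp
  | succ n ih =>
    have hmp := (measurePreserving_piFinSuccAbove μ 0).symm
    rw [← hmp.lintegral_comp (by fun_prop)]
    simp only [Fin.prod_univ_succ]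
    have : ∀ z : X × (Fin n → X),
        f 0 ((MeasurableEquiv.piFinSuccAbove (fun _ : Fin (n+1) => X) 0).symm z 0) *
          ∏ i : Fin n, f i.succ ((MeasurableEquiv.piFinSuccAbove
            (fun _ : Fin (n+1) => X) 0).symm z i.succ)
        = f 0 z.1 * ∏ i : Fin n, f i.succ (z.2 i) := by
      intro z
      simp [MeasurableEquiv.piFinSuccAbove, Fin.insertNthEquiv]
    simp only [this]
    rw [lintegral_prod_mul (f := f 0) (g := fun z : Fin n → X => ∏ i, f i.succ (z i))
      (hf 0).aemeasurable
      (Finset.measurable_prod _ fun i _ => (hf _).comp (measurable_pi_apply _)).aemeasurable]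
    congr 1
    exact ih (fun i => μ (Fin.succ i)) (fun i => f i.succ) (fun i => hf _)

lemma aux_pi_withDensity {X : Type*} [MeasurableSpace X] {n : ℕ} (μ : Fin n → Measure X)
    [∀ i, SigmaFinite (μ i)] (f : Fin n → X → ℝ≥0∞) (hf : ∀ i, Measurable (f i))
    [∀ i, SigmaFinite ((μ i).withDensity (f i))] :
    Measure.pi (fun i => (μ i).withDensity (f i))
      = (Measure.pi μ).withDensity (fun x => ∏ i, f i (x i)) := by
  apply Measure.pi_eq
  intro s hs
  rw [withDensity_apply _ (MeasurableSet.univ_pi hs), Measure.restrict_pi_pi,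
    aux_lintegral_pi_prod _ _ hf]
  refine Finset.prod_congr rfl fun i _ => ?_
  rw [withDensity_apply _ (hs i)]

lemma aux_null_pi {X : Type*} [MeasurableSpace X] {n : ℕ} (μ : Fin n → Measure X)
    [∀ i, SigmaFinite (μ i)] (k : Fin n) {S : Set (Fin n → X)} (hS : MeasurableSet S)
    (h : ∀ z : Fin n → X, μ k {x | Function.update z k x ∈ S} = 0) :
    Measure.pi μ S = 0 := by
  obtain _ | n := n
  · exact k.elim0
  have hmp := (measurePreserving_piFinSuccAbove μ k).symm
  rw [← hmp.measure_preimage hS.nullMeasurableSet]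
  have hm : MeasurableSet (((MeasurableEquiv.piFinSuccAbove (fun _ : Fin (n+1) => X) k).symm) ⁻¹' S) :=
    hmp.measurable hS
  rw [← Measure.prod_swap, Measure.map_apply measurable_swap hm,
    Measure.measure_prod_null (measurable_swap hm)]
  refine Filter.Eventually.of_forall fun z => ?_
  simp only [Pi.zero_apply]
  by_cases hne : Nonempty X
  · obtain ⟨x0⟩ := hne
    refine measure_mono_null ?_ (h (k.insertNth x0 z))
    intro x hx
    simpa [MeasurableEquiv.piFinSuccAbove, Fin.insertNthEquiv] using hx
  · have : IsEmpty X := not_nonempty_iff.mp hne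
    have : (μ k) = 0 := Measure.eq_zero_of_isEmpty _
    simp [this]

lemma aux_pi_swap {X : Type*} [MeasurableSpace X] {p n : ℕ} (μ : Fin p → Fin n → Measure X)
    [∀ i j, IsProbabilityMeasure (μ i j)] :
    (Measure.pi fun j => Measure.pi fun i => μ i j).map (fun (x : Fin n → Fin p → X) i j => x j i)
      = Measure.pi fun i => Measure.pi fun j => μ i j := by
  symm
  have hfs : ∀ i : Fin p, (Measure.pi fun j => μ i j).FiniteSpanningSetsIn
      (Set.pi Set.univ '' Set.pi Set.univ fun _ : Fin n => {s : Set X | MeasurableSet s}) :=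
    fun i =>
      { set := fun _ => Set.univ
        set_mem := fun _ => ⟨fun _ => Set.univ, by simp, by simp⟩
        finite := fun _ => by simp
        spanning := Set.iUnion_const _ }
  refine Measure.pi_eq_generateFrom (fun i => generateFrom_pi)
    (fun i => isPiSystem_pi) hfs ?_
  intro s hs
  choose t ht hts using hs
  have hms : MeasurableSet (Set.univ.pi s) := by
    refine MeasurableSet.univ_pi fun i => ?_
    rw [← hts i]
    exact MeasurableSet.univ_pi fun j => ht i j (Set.mem_univ j)
  rw [Measure.map_apply (by fun_prop) hms]
  have : (fun (x : Fin n → Fin p → X) i j => x j i) ⁻¹' (Set.univ.pi s)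
      = Set.univ.pi fun j => Set.univ.pi fun i => t i j := by
    ext x
    simp only [Set.mem_preimage, Set.mem_pi, Set.mem_univ, true_imp_iff, ← hts]
    exact forall_comm
  rw [this, Measure.pi_pi]
  have h2 : ∀ i, (Measure.pi fun j => μ i j) (s i) = ∏ j, μ i j (t i j) := by
    intro i; rw [← hts i, Measure.pi_pi]
  simp only [Measure.pi_pi, h2]
  exact Finset.prod_comm

/-! ### Densities -/

lemma aux_var_ne {σ : ℝ} (hσ : 0 < σ) : (σ ^ 2).toNNReal ≠ 0 := by
  simpa using hσ.ne'

lemma aux_lawY_eq {p n : ℕ} {σ : ℝ} (hσ : 0 < σ) (θ : Fin p → ℝ) (η : Fin n → ℝ) :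
    lawY p n σ θ η = (volume : Measure (Fin p → Fin n → ℝ)).withDensity
      (fun y => ∏ i, ∏ j, gaussianPDF (θ i * η j) (σ ^ 2).toNNReal (y i j)) := by
  have h1 : ∀ i, (Measure.pi fun j => gaussianReal (θ i * η j) (σ ^ 2).toNNReal)
      = (volume : Measure (Fin n → ℝ)).withDensity
        (fun r => ∏ j, gaussianPDF (θ i * η j) (σ ^ 2).toNNReal (r j)) := by
    intro i
    have h2 : ∀ j, gaussianReal (θ i * η j) (σ ^ 2).toNNReal
        = (volume : Measure ℝ).withDensity (gaussianPDF (θ i * η j) (σ ^ 2).toNNReal) :=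
      fun j => gaussianReal_of_var_ne_zero _ (aux_var_ne hσ)
    have : ∀ j, SigmaFinite ((volume : Measure ℝ).withDensity
        (gaussianPDF (θ i * η j) (σ ^ 2).toNNReal)) := by
      intro j; rw [← h2 j]; infer_instance
    simp_rw [h2]
    rw [volume_pi]
    exact aux_pi_withDensity (fun _ => volume) _ (fun j => measurable_gaussianPDF _ _)
  have : ∀ i, SigmaFinite ((volume : Measure (Fin n → ℝ)).withDensity
        (fun r => ∏ j, gaussianPDF (θ i * η j) (σ ^ 2).toNNReal (r j))) := by
    intro i; rw [← h1 i]; infer_instance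
  have h3 : lawY p n σ θ η = Measure.pi fun i => (volume : Measure (Fin n → ℝ)).withDensity
        (fun r => ∏ j, gaussianPDF (θ i * η j) (σ ^ 2).toNNReal (r j)) := by
    unfold lawY
    congr 1
    exact funext h1
  rw [h3]
  have h4 := aux_pi_withDensity (fun _ : Fin p => (volume : Measure (Fin n → ℝ)))
    (fun i r => ∏ j, gaussianPDF (θ i * η j) (σ ^ 2).toNNReal (r j)) (fun i =>
    Finset.measurable_prod _ fun j _ => (measurable_gaussianPDF _ _).comp (measurable_pi_apply _))
  rw [← volume_pi] at h4
  exact h4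

/-- one-row marginal density: depends on the labels only through an increasing function of
`(∑ η_j y_j)²`. -/
lemma aux_row {n : ℕ} {σ α : ℝ} (hσ : 0 < σ) (hα : 0 < α) :
    ∃ (c : ℝ) (K : (Fin n → ℝ) → ℝ≥0∞), 0 < c ∧ ∀ η ∈ pmOne n, ∀ y : Fin n → ℝ,
      ∫⁻ t, ∏ j, gaussianPDF (t * η j) (σ ^ 2).toNNReal (y j)
          ∂(gaussianReal 0 (α ^ 2).toNNReal)
        = K y * ENNReal.ofReal (Real.exp (c * (∑ j, η j * y j) ^ 2)) := by
  have hden : 0 < 1 / α ^ 2 + n / σ ^ 2 := by positivity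
  set v : ℝ := 1 / (1 / α ^ 2 + n / σ ^ 2) with hv
  have hvpos : 0 < v := by positivity
  refine ⟨v / (2 * σ ^ 4), fun y => (∫⁻ t : ℝ, ENNReal.ofReal (Real.exp (-(t ^ 2 / (2 * v))))) *
    ENNReal.ofReal ((Real.sqrt (2 * Real.pi * α ^ 2))⁻¹ * (Real.sqrt (2 * Real.pi * σ ^ 2))⁻¹ ^ n
      * Real.exp (-(∑ j, y j ^ 2) / (2 * σ ^ 2))), by positivity, ?_⟩
  intro η hη y
  set s := ∑ j, η j * y j with hs
  have hcσ : (((σ ^ 2).toNNReal : NNReal) : ℝ) = σ ^ 2 := Real.coe_toNNReal _ (by positivity)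
  have hcα : (((α ^ 2).toNNReal : NNReal) : ℝ) = α ^ 2 := Real.coe_toNNReal _ (by positivity)
  rw [gaussianReal_of_var_ne_zero _ (aux_var_ne hα),
    lintegral_withDensity_eq_lintegral_mul₀ (measurable_gaussianPDF _ _).aemeasurable
      (by fun_prop)]
  have hη2 : ∀ j, η j ^ 2 = 1 := by
    intro j; rcases hη j with h | h <;> rw [h] <;> norm_num
  have key : ∀ t : ℝ, (gaussianPDF 0 (α ^ 2).toNNReal *
      fun t => ∏ j, gaussianPDF (t * η j) (σ ^ 2).toNNReal (y j)) t
      = ENNReal.ofReal (Real.exp (-((t - v * s / σ ^ 2) ^ 2 / (2 * v)))) *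
        (ENNReal.ofReal ((Real.sqrt (2 * Real.pi * α ^ 2))⁻¹ *
          (Real.sqrt (2 * Real.pi * σ ^ 2))⁻¹ ^ n * Real.exp (-(∑ j, y j ^ 2) / (2 * σ ^ 2))) *
        ENNReal.ofReal (Real.exp (v / (2 * σ ^ 4) * s ^ 2))) := by
    intro t
    simp only [Pi.mul_apply, gaussianPDF]
    rw [← ENNReal.ofReal_prod_of_nonneg (fun j _ => gaussianPDFReal_nonneg _ _ _),
      ← ENNReal.ofReal_mul (gaussianPDFReal_nonneg _ _ _), ← ENNReal.ofReal_mul (by positivity),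
      ← ENNReal.ofReal_mul (by positivity)]
    congr 1
    simp only [gaussianPDFReal, hcσ, hcα]
    rw [Finset.prod_mul_distrib, ← Real.exp_sum]
    simp only [Finset.prod_const, Finset.card_univ, Fintype.card_fin]
    have hsum : ∑ j, -(y j - t * η j) ^ 2 / (2 * σ ^ 2)
        = (-(∑ j, y j ^ 2) + 2 * t * s - n * t ^ 2) / (2 * σ ^ 2) := by
      rw [← Finset.sum_div]
      congr 1
      have : ∀ j, -(y j - t * η j) ^ 2 = -(y j ^ 2) + 2 * t * (η j * y j) - t ^ 2 := by
        intro j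
        have := hη2 j
        linear_combination (-t ^ 2) * this
      simp only [this, Finset.sum_sub_distrib, Finset.sum_add_distrib, Finset.sum_neg_distrib,
        ← Finset.mul_sum, hs]
      simp
    rw [hsum]
    have hexp : Real.exp (-(t - 0) ^ 2 / (2 * α ^ 2)) *
        Real.exp ((-(∑ j, y j ^ 2) + 2 * t * s - n * t ^ 2) / (2 * σ ^ 2))
        = Real.exp (-((t - v * s / σ ^ 2) ^ 2 / (2 * v))) *
          Real.exp (-(∑ j, y j ^ 2) / (2 * σ ^ 2)) * Real.exp (v / (2 * σ ^ 4) * s ^ 2) := by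
      rw [← Real.exp_add, ← Real.exp_add, ← Real.exp_add]
      congr 1
      have hvi : 1 / v = 1 / α ^ 2 + n / σ ^ 2 := by rw [hv]; simp
      have e1 : -((t - v * s / σ ^ 2) ^ 2 / (2 * v))
          = -(t ^ 2 / 2) * (1 / v) + t * s / σ ^ 2 - v / (2 * σ ^ 4) * s ^ 2 := by
        field_simp
        ring
      rw [e1, hvi]
      field_simp
      ring
    calc _ = (Real.sqrt (2 * Real.pi * α ^ 2))⁻¹ * (Real.sqrt (2 * Real.pi * σ ^ 2))⁻¹ ^ n *
          (Real.exp (-(t - 0) ^ 2 / (2 * α ^ 2)) *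
          Real.exp ((-(∑ j, y j ^ 2) + 2 * t * s - n * t ^ 2) / (2 * σ ^ 2))) := by ring
      _ = _ := by rw [hexp]; ring
  simp_rw [key]
  have htr := lintegral_sub_right_eq_self (μ := volume)
    (fun t : ℝ => ENNReal.ofReal (Real.exp (-(t ^ 2 / (2 * v))))) (v * s / σ ^ 2)
  rw [lintegral_mul_const _ (by fun_prop), htr]
  exact (mul_assoc _ _ _).symm

lemma aux_dens_meas {p n : ℕ} (σ : ℝ) (η : Fin n → ℝ) :
    Measurable (Function.uncurry fun (θ : Fin p → ℝ) (y : Fin p → Fin n → ℝ) =>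
      ∏ i, ∏ j, gaussianPDF (θ i * η j) (σ ^ 2).toNNReal (y i j)) := by
  simp only [Function.uncurry_def]
  fun_prop

/-- Marginal density -/
lemma aux_marg {p n : ℕ} {σ α : ℝ} (hσ : 0 < σ) (hα : 0 < α) :
    ∃ (c : ℝ) (K : (Fin p → Fin n → ℝ) → ℝ≥0∞), 0 < c ∧ ∀ η ∈ pmOne n, ∀ y,
      ∫⁻ θ : Fin p → ℝ, ∏ i, ∏ j, gaussianPDF (θ i * η j) (σ ^ 2).toNNReal (y i j)
          ∂(gaussVec p (α ^ 2))
        = K y * ENNReal.ofReal (Real.exp (c * ∑ i, (∑ j, η j * y i j) ^ 2)) := by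
  obtain ⟨c, K, hc, h⟩ := aux_row (n := n) hσ hα
  refine ⟨c, fun y => ∏ i, K (y i), hc, fun η hη y => ?_⟩
  unfold gaussVec
  rw [aux_lintegral_pi_prod _
    (fun i t => ∏ j, gaussianPDF (t * η j) (σ ^ 2).toNNReal (y i j)) (fun i => by fun_prop)]
  simp_rw [h η hη]
  rw [Finset.prod_mul_distrib, ← ENNReal.ofReal_prod_of_nonneg (fun _ _ => by positivity),
    ← Real.exp_sum, Finset.mul_sum]

lemma aux_swap {p n : ℕ} {σ : ℝ} (α : ℝ) (hσ : 0 < σ) (η : Fin n → ℝ)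
    {A : Set (Fin p → Fin n → ℝ)} (hA : MeasurableSet A) :
    Measurable (fun θ => lawY p n σ θ η A) ∧
    ∫⁻ θ, lawY p n σ θ η A ∂(gaussVec p (α ^ 2)) = ∫⁻ y in A,
      ∫⁻ θ : Fin p → ℝ, ∏ i, ∏ j, gaussianPDF (θ i * η j) (σ ^ 2).toNNReal (y i j)
          ∂(gaussVec p (α ^ 2)) := by
  have h1 : ∀ θ, lawY p n σ θ η A = ∫⁻ y in A,
      ∏ i, ∏ j, gaussianPDF (θ i * η j) (σ ^ 2).toNNReal (y i j) := by
    intro θ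
    rw [aux_lawY_eq hσ, withDensity_apply _ hA]
  have : IsProbabilityMeasure (gaussVec p (α ^ 2)) := by unfold gaussVec; infer_instance
  simp_rw [h1]
  refine ⟨(aux_dens_meas σ η).lintegral_prod_right', ?_⟩
  exact lintegral_lintegral_swap (aux_dens_meas σ η).aemeasurable

/-! ### The oracle test region -/

/-- Region where the oracle test errs for label `i`. -/
def auxT {p m : ℕ} (η : Fin (m + 1) → ℝ) (i : Fin (m + 1)) : Set (Fin p → Fin (m + 1) → ℝ) :=
  {y | ∑ a, (η i * y a i) * (∑ j, η (i.succAbove j) * y a (i.succAbove j)) ≤ 0}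

lemma auxT_meas {p m : ℕ} (η : Fin (m + 1) → ℝ) (i : Fin (m + 1)) :
    MeasurableSet (auxT (p := p) η i) := by
  unfold auxT
  exact measurableSet_le (by fun_prop) (by fun_prop)

lemma aux_gauss_map {σ : ℝ} (hσ : 0 < σ) (t e : ℝ) (he : e = 1 ∨ e = -1) :
    (gaussianReal 0 (1 : ℝ).toNNReal).map (fun x => e * (t + σ * x))
      = gaussianReal (t * e) (σ ^ 2).toNNReal := by
  have h1 : (fun x : ℝ => e * (t + σ * x)) = (fun x => e * t + x) ∘ (fun x => (e * σ) * x) := by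
    funext x; simp; ring
  rw [h1, ← Measure.map_map (by fun_prop) (by fun_prop), gaussianReal_map_const_mul,
    gaussianReal_map_const_add]
  have he2 : e ^ 2 = 1 := by rcases he with h | h <;> rw [h] <;> norm_num
  congr 1
  · ring
  · ext
    simp only [Real.toNNReal_one, NNReal.coe_mk, mul_one]
    rw [Real.coe_toNNReal _ (by positivity), mul_pow, he2, one_mul]

lemma aux_lawY_map {p m : ℕ} {σ : ℝ} (hσ : 0 < σ) (θ : Fin p → ℝ) {η : Fin (m + 1) → ℝ}
    (hη : η ∈ pmOne (m + 1)) (i : Fin (m + 1)) :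
    MeasurePreserving (fun (ξ : (Fin p → ℝ) × (Fin m → Fin p → ℝ)) (a : Fin p) (j : Fin (m + 1)) =>
        η j * (θ a + σ * (i.insertNth ξ.1 ξ.2 : Fin (m + 1) → Fin p → ℝ) j a))
      ((gaussVec p 1).prod (Measure.pi fun _ : Fin m => gaussVec p 1))
      (lawY p (m + 1) σ θ η) := by
  have hgp : IsProbabilityMeasure (gaussVec p 1) := by unfold gaussVec; infer_instance
  have s1 := (measurePreserving_piFinSuccAbove (fun _ : Fin (m + 1) => gaussVec p 1) i).symm
  have s2 : MeasurePreserving (fun (x : Fin (m + 1) → Fin p → ℝ) j a => η j * (θ a + σ * x j a))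
      (Measure.pi fun _ => gaussVec p 1)
      (Measure.pi fun j => Measure.pi fun a => gaussianReal (θ a * η j) (σ ^ 2).toNNReal) := by
    refine measurePreserving_pi (fun _ : Fin (m + 1) => gaussVec p 1) _
      (f := fun j (x : Fin p → ℝ) a => η j * (θ a + σ * x a)) fun j => ?_
    unfold gaussVec
    refine measurePreserving_pi (fun _ : Fin p => gaussianReal 0 (1 : ℝ).toNNReal) _
      (f := fun a (x : ℝ) => η j * (θ a + σ * x)) fun a => ?_
    exact ⟨by fun_prop, aux_gauss_map hσ _ _ (hη j)⟩
  have s3 : MeasurePreserving (fun (x : Fin (m + 1) → Fin p → ℝ) i j => x j i)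
      (Measure.pi fun j => Measure.pi fun a => gaussianReal (θ a * η j) (σ ^ 2).toNNReal)
      (lawY p (m + 1) σ θ η) :=
    ⟨by fun_prop, aux_pi_swap (fun a j => gaussianReal (θ a * η j) (σ ^ 2).toNNReal)⟩
  exact s3.comp (s2.comp s1)

lemma aux_lawY_T {p m : ℕ} {σ : ℝ} (hm : 1 ≤ m) (hσ : 0 < σ) (θ : Fin p → ℝ)
    {η : Fin (m + 1) → ℝ} (hη : η ∈ pmOne (m + 1)) (i : Fin (m + 1)) :
    lawY p (m + 1) σ θ η (auxT η i) = ENNReal.ofReal (Gfun p (m + 1) σ 0 θ) := by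
  have hgp : IsProbabilityMeasure (gaussVec p 1) := by unfold gaussVec; infer_instance
  rw [← (aux_lawY_map hσ θ hη i).measure_preimage (auxT_meas η i).nullMeasurableSet]
  unfold Gfun
  rw [ENNReal.ofReal_toReal (by exact measure_ne_top _ _)]
  refine congrArg ((gaussVec p 1).prod (Measure.pi fun _ : Fin m => gaussVec p 1)) ?_
  ext ξ
  have hη2 : ∀ j, η j * η j = 1 := by
    intro j; rcases hη j with h | h <;> rw [h] <;> norm_num
  have hm0 : (0 : ℝ) < m := by exact_mod_cast hm
  simp only [auxT, Set.mem_preimage, Set.mem_ofPred_eq, Fin.insertNth_apply_same,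
    Fin.insertNth_apply_succAbove, mul_zero]
  have e1 : ∀ (j : Fin (m + 1)) (x : ℝ), η j * (η j * x) = x := by
    intro j x; rw [← mul_assoc, hη2, one_mul]
  simp only [e1]
  have e2 : ∑ a, (θ a + σ * ξ.1 a) * ∑ j : Fin m, (θ a + σ * ξ.2 j a)
      = m * ∑ a, (θ a + σ * ξ.1 a) *
        (θ a + σ / (((m + 1 : ℕ) : ℝ) - 1) * ∑ j : Fin m, ξ.2 j a) := by
    rw [Finset.mul_sum]
    refine Finset.sum_congr rfl fun a _ => ?_
    rw [Finset.sum_add_distrib, ← Finset.mul_sum]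
    simp only [Finset.sum_const, Finset.card_univ, Fintype.card_fin, nsmul_eq_mul]
    push_cast
    rw [add_sub_cancel_right]
    field_simp
  rw [e2]
  constructor
  · intro h
    exact nonpos_of_mul_nonpos_right h hm0
  · intro h
    exact mul_nonpos_of_nonneg_of_nonpos hm0.le h

lemma aux_lawY_Z {p m : ℕ} {σ : ℝ} (hp : 1 ≤ p) (hm : 1 ≤ m) (hσ : 0 < σ) (θ : Fin p → ℝ)
    (η : Fin (m + 1) → ℝ) {b : Fin (m + 1) → ℝ} (hb : b ∈ pmOne (m + 1)) (i : Fin (m + 1)) :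
    lawY p (m + 1) σ θ η
      {y | ∑ a, (b i * y a i) * (∑ j, b (i.succAbove j) * y a (i.succAbove j)) = 0} = 0 := by
  have hNA : ∀ t : ℝ, NullSingletonClass (gaussianReal t (σ ^ 2).toNNReal) :=
    fun t => nullSingletonClass_gaussianReal (aux_var_ne hσ)
  have hb0 : ∀ j, b j ≠ 0 := by
    intro j; rcases hb j with h | h <;> rw [h] <;> norm_num
  let a0 : Fin p := ⟨0, hp⟩
  let j0 : Fin m := ⟨0, hm⟩
  let S : (Fin (m + 1) → ℝ) → ℝ := fun r => ∑ j, b (i.succAbove j) * r (i.succAbove j)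
  have hSm : Measurable S := by fun_prop
  have hsub : ∀ (c : ℝ) (P : Prop) (u v : ℝ), (P → u ≠ 0) →
      gaussianReal c (σ ^ 2).toNNReal {x | u * x + v = 0 ∧ P} = 0 := by
    intro c P u v hu
    have := hNA c
    refine Set.Subsingleton.measure_zero ?_ _
    intro x hx y hy
    have h0 := hu hx.2
    have : u * x = u * y := by linarith [hx.1, hy.1]
    exact mul_left_cancel₀ h0 this
  have n1 : ∀ (c : Fin (m + 1) → ℝ),
      (Measure.pi fun j => gaussianReal (c j) (σ ^ 2).toNNReal) {r | S r = 0} = 0 := by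
    intro c
    refine aux_null_pi _ (i.succAbove j0) (hSm (measurableSet_singleton 0)) fun z => ?_
    refine measure_mono_null ?_ (hsub _ True (b (i.succAbove j0))
      (∑ j ∈ Finset.univ.erase j0, b (i.succAbove j) * z (i.succAbove j)) (fun _ => hb0 _))
    intro x hx
    refine ⟨?_, trivial⟩
    have hx' : S (Function.update z (i.succAbove j0) x) = 0 := hx
    simp only [S] at hx'
    rw [← Finset.add_sum_erase _ _ (Finset.mem_univ j0)] at hx'
    rw [← hx']
    simp only [Function.update_self]
    congr 1
    refine Finset.sum_congr rfl fun j hj => ?_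
    rw [Function.update_of_ne]
    intro h
    exact (Finset.ne_of_mem_erase hj) (Fin.succAbove_right_injective h)
  have n2 : ∀ (c : Fin (m + 1) → ℝ) (C : ℝ),
      (Measure.pi fun j => gaussianReal (c j) (σ ^ 2).toNNReal)
        {r | (b i * r i) * S r + C = 0 ∧ S r ≠ 0} = 0 := by
    intro c C
    have hms : MeasurableSet {r : Fin (m + 1) → ℝ | (b i * r i) * S r + C = 0 ∧ S r ≠ 0} :=
      (measurableSet_eq_fun (by fun_prop) (by fun_prop)).inter
        (measurableSet_eq_fun (by fun_prop) (by fun_prop)).compl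
    refine aux_null_pi _ i hms fun z => ?_
    refine measure_mono_null ?_ (hsub _ (S z ≠ 0) (b i * S z) C
      (fun h => mul_ne_zero (hb0 i) h))
    intro x hx
    have hS : S (Function.update z i x) = S z := by
      simp only [S]
      refine Finset.sum_congr rfl fun j _ => ?_
      rw [Function.update_of_ne (Fin.succAbove_ne i j)]
    simp only [Set.mem_ofPred_eq, hS, Function.update_self] at hx ⊢
    refine ⟨?_, hx.2⟩
    rw [← hx.1]; ring
  have hrow : ∀ y : Fin p → Fin (m + 1) → ℝ,
      ∑ a, (b i * y a i) * (∑ j, b (i.succAbove j) * y a (i.succAbove j))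
        = ∑ a, (b i * y a i) * S (y a) := fun y => rfl
  have hm1 : MeasurableSet {y : Fin p → Fin (m + 1) → ℝ | S (y a0) = 0} :=
    measurableSet_eq_fun (by fun_prop) (by fun_prop)
  have hm2 : MeasurableSet {y : Fin p → Fin (m + 1) → ℝ |
      ∑ a, (b i * y a i) * S (y a) = 0 ∧ S (y a0) ≠ 0} :=
    (measurableSet_eq_fun (by fun_prop) (by fun_prop)).inter hm1.compl
  have z1 : lawY p (m + 1) σ θ η {y | S (y a0) = 0} = 0 := by
    refine aux_null_pi _ a0 hm1 fun z => ?_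
    simpa using n1 (fun j => θ a0 * η j)
  have z2 : lawY p (m + 1) σ θ η {y | ∑ a, (b i * y a i) * S (y a) = 0 ∧ S (y a0) ≠ 0} = 0 := by
    refine aux_null_pi _ a0 hm2 fun z => ?_
    refine measure_mono_null ?_ (n2 (fun j => θ a0 * η j)
      (∑ a ∈ Finset.univ.erase a0, (b i * z a i) * S (z a)))
    intro r hr
    simp only [Set.mem_ofPred_eq, Function.update_self] at hr ⊢
    refine ⟨?_, hr.2⟩
    rw [← hr.1, ← Finset.add_sum_erase _ _ (Finset.mem_univ a0)]
    simp only [Function.update_self]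
    congr 1
    refine Finset.sum_congr rfl fun a ha => ?_
    rw [Function.update_of_ne (Finset.ne_of_mem_erase ha)]
  refine measure_mono_null ?_ (measure_union_null z1 z2)
  intro y hy
  by_cases h : S (y a0) = 0
  · exact Or.inl h
  · exact Or.inr ⟨hy, h⟩

/-! ### Neyman-Pearson step -/

lemma aux_flip_mem {n : ℕ} {η : Fin n → ℝ} (hη : η ∈ pmOne n) (i : Fin n) :
    Function.update η i (-η i) ∈ pmOne n := by
  intro j
  by_cases h : j = i
  · subst h
    rcases hη j with h | h <;> simp [h]
  · rw [Function.update_of_ne h]; exact hη j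

lemma aux_NP {p m : ℕ} {σ α : ℝ} (hp : 1 ≤ p) (hm : 1 ≤ m) (hσ : 0 < σ) (hα : 0 < α)
    {η : Fin (m + 1) → ℝ} (hη : η ∈ pmOne (m + 1)) (i : Fin (m + 1))
    {A : Set (Fin p → Fin (m + 1) → ℝ)} (hA : MeasurableSet A) :
    ∫⁻ θ, ENNReal.ofReal (Gfun p (m + 1) σ 0 θ) ∂(gaussVec p (α ^ 2))
      + ∫⁻ θ, ENNReal.ofReal (Gfun p (m + 1) σ 0 θ) ∂(gaussVec p (α ^ 2))
    ≤ ∫⁻ θ, lawY p (m + 1) σ θ η A ∂(gaussVec p (α ^ 2))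
      + ∫⁻ θ, lawY p (m + 1) σ θ (Function.update η i (-η i)) Aᶜ ∂(gaussVec p (α ^ 2)) := by
  set η' := Function.update η i (-η i) with hη'def
  have hη' : η' ∈ pmOne (m + 1) := aux_flip_mem hη i
  have hi : η' i = -η i := by simp [η']
  have hj : ∀ j, η' (i.succAbove j) = η (i.succAbove j) := by
    intro j; simp [η']
  have hT := auxT_meas (p := p) η i
  have g1 : ∫⁻ θ, ENNReal.ofReal (Gfun p (m + 1) σ 0 θ) ∂(gaussVec p (α ^ 2))
      = ∫⁻ θ, lawY p (m + 1) σ θ η (auxT η i) ∂(gaussVec p (α ^ 2)) := by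
    simp_rw [aux_lawY_T hm hσ _ hη i]
  have g2 : ∫⁻ θ, ENNReal.ofReal (Gfun p (m + 1) σ 0 θ) ∂(gaussVec p (α ^ 2))
      ≤ ∫⁻ θ, lawY p (m + 1) σ θ η' (auxT η i)ᶜ ∂(gaussVec p (α ^ 2)) := by
    refine lintegral_mono fun θ => ?_
    rw [← aux_lawY_T hm hσ θ hη' i]
    have hz := aux_lawY_Z hp hm hσ θ η' hη' i
    set Z : Set (Fin p → Fin (m + 1) → ℝ) :=
      {y | ∑ a, (η' i * y a i) * (∑ j, η' (i.succAbove j) * y a (i.succAbove j)) = 0} with hZ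
    have hsub : auxT η' i ⊆ (auxT η i)ᶜ ∪ Z := by
      intro y hy
      simp only [auxT, Set.mem_ofPred_eq] at hy
      rcases hy.lt_or_eq with h | h
      · left
        simp only [auxT, Set.mem_compl_iff, Set.mem_ofPred_eq, not_le]
        simp only [hi, hj, neg_mul, Finset.sum_neg_distrib] at h
        linarith
      · right; exact h
    calc _ ≤ lawY p (m + 1) σ θ η' ((auxT η i)ᶜ ∪ Z) := measure_mono hsub
      _ ≤ lawY p (m + 1) σ θ η' (auxT η i)ᶜ + lawY p (m + 1) σ θ η' Z := measure_union_le _ _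
      _ = _ := by rw [hz, add_zero]
  obtain ⟨c, K, hc, hK⟩ := aux_marg (p := p) (n := m + 1) hσ hα
  rw [(aux_swap α hσ η hA).2, (aux_swap α hσ η' hA.compl).2]
  rw [(aux_swap α hσ η hT).2] at g1
  rw [(aux_swap α hσ η' hT.compl).2] at g2
  simp_rw [hK η hη, hK η' hη'] at *
  refine le_trans (add_le_add g1.le g2) ?_
  set q := fun y : Fin p → Fin (m + 1) → ℝ =>
    K y * ENNReal.ofReal (Real.exp (c * ∑ i, (∑ j, η j * y i j) ^ 2)) with hq
  set q' := fun y : Fin p → Fin (m + 1) → ℝ =>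
    K y * ENNReal.ofReal (Real.exp (c * ∑ i, (∑ j, η' j * y i j) ^ 2)) with hq'
  have hqm : Measurable q := by
    have : q = fun y => ∫⁻ θ : Fin p → ℝ,
        ∏ i, ∏ j, gaussianPDF (θ i * η j) (σ ^ 2).toNNReal (y i j) ∂(gaussVec p (α ^ 2)) := by
      funext y; rw [hK η hη]
    rw [this]
    have hgp : IsProbabilityMeasure (gaussVec p (α ^ 2)) := by unfold gaussVec; infer_instance
    exact (aux_dens_meas σ η).lintegral_prod_left'
  have hdiff : ∀ y : Fin p → Fin (m + 1) → ℝ, ∑ i, (∑ j, η j * y i j) ^ 2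
      = ∑ i, (∑ j, η' j * y i j) ^ 2 +
        4 * ∑ a, (η i * y a i) * (∑ j, η (i.succAbove j) * y a (i.succAbove j)) := by
    intro y
    rw [Finset.mul_sum, ← Finset.sum_add_distrib]
    refine Finset.sum_congr rfl fun a _ => ?_
    rw [Fin.sum_univ_succAbove _ i, Fin.sum_univ_succAbove (fun j => η' j * y a j) i]
    simp only [hi, hj]
    ring
  have le1 : ∀ y ∈ auxT η i, q y ≤ q' y := by
    intro y hy
    simp only [auxT, Set.mem_ofPred_eq] at hy
    simp only [hq, hq']
    refine mul_le_mul_right (ENNReal.ofReal_le_ofReal (Real.exp_le_exp.mpr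
      (mul_le_mul_of_nonneg_left ?_ hc.le))) _
    rw [hdiff y]; linarith
  have le2 : ∀ y ∉ auxT η i, q' y ≤ q y := by
    intro y hy
    simp only [auxT, Set.mem_ofPred_eq, not_le] at hy
    simp only [hq, hq']
    refine mul_le_mul_right (ENNReal.ofReal_le_ofReal (Real.exp_le_exp.mpr
      (mul_le_mul_of_nonneg_left ?_ hc.le))) _
    rw [hdiff y]; linarith
  rw [← lintegral_indicator hT, ← lintegral_indicator hT.compl, ← lintegral_indicator hA,
    ← lintegral_indicator hA.compl, ← lintegral_add_left (hqm.indicator hT),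
    ← lintegral_add_left (hqm.indicator hA)]
  refine lintegral_mono fun y => ?_
  by_cases h1 : y ∈ auxT η i <;> by_cases h2 : y ∈ A <;> simp [h1, h2]
  · exact le1 y h1
  · exact le2 y h1

lemma aux_NP_real {p m : ℕ} {σ α : ℝ} (hp : 1 ≤ p) (hm : 1 ≤ m) (hσ : 0 < σ) (hα : 0 < α)
    {η : Fin (m + 1) → ℝ} (hη : η ∈ pmOne (m + 1)) (i : Fin (m + 1))
    {A : Set (Fin p → Fin (m + 1) → ℝ)} (hA : MeasurableSet A) :
    2 * ∫ θ, Gfun p (m + 1) σ 0 θ ∂(gaussVec p (α ^ 2))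
    ≤ ∫ θ, (lawY p (m + 1) σ θ η).real A ∂(gaussVec p (α ^ 2))
      + ∫ θ, (lawY p (m + 1) σ θ (Function.update η i (-η i))).real Aᶜ
        ∂(gaussVec p (α ^ 2)) := by
  have hgp : IsProbabilityMeasure (gaussVec p (α ^ 2)) := by unfold gaussVec; infer_instance
  have hlp : ∀ θ η, IsProbabilityMeasure (lawY p (m + 1) σ θ η) := by
    intro θ η; unfold lawY; infer_instance
  have hG : ∀ θ, Gfun p (m + 1) σ 0 θ = (lawY p (m + 1) σ θ η (auxT η i)).toReal := by
    intro θ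
    rw [aux_lawY_T hm hσ θ hη i, ENNReal.toReal_ofReal]
    exact ENNReal.toReal_nonneg
  have conv : ∀ (η : Fin (m + 1) → ℝ) {B : Set (Fin p → Fin (m + 1) → ℝ)}, MeasurableSet B →
      ∫ θ, (lawY p (m + 1) σ θ η B).toReal ∂(gaussVec p (α ^ 2))
        = (∫⁻ θ, lawY p (m + 1) σ θ η B ∂(gaussVec p (α ^ 2))).toReal := by
    intro η B hB
    exact integral_toReal (aux_swap α hσ η hB).1.aemeasurable
      (Filter.Eventually.of_forall fun θ => measure_lt_top _ _)
  have fin : ∀ (η : Fin (m + 1) → ℝ) (B : Set (Fin p → Fin (m + 1) → ℝ)),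
      ∫⁻ θ, lawY p (m + 1) σ θ η B ∂(gaussVec p (α ^ 2)) ≠ ∞ := by
    intro η B
    refine ne_top_of_le_ne_top ENNReal.one_ne_top ?_
    calc _ ≤ ∫⁻ θ, 1 ∂(gaussVec p (α ^ 2)) := lintegral_mono fun θ => prob_le_one
      _ = 1 := by simp
  have h := aux_NP hp hm hσ hα hη i hA
  simp_rw [← aux_lawY_T hm hσ _ hη i] at h
  simp_rw [hG, Measure.real]
  rw [conv η hA, conv _ hA.compl, conv η (auxT_meas η i), two_mul,
    ← ENNReal.toReal_add (fin _ _) (fin _ _), ← ENNReal.toReal_add (fin _ _) (fin _ _)]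
  exact ENNReal.toReal_mono (ENNReal.add_ne_top.mpr ⟨fin _ _, fin _ _⟩) h

/-! ### The loss -/

/-- Set of observations on which the relative label of `i,j` is misestimated. -/
def auxA {p n : ℕ} (f : (Fin p → Fin n → ℝ) → Fin n → ℝ) (η : Fin n → ℝ) (i j : Fin n) :
    Set (Fin p → Fin n → ℝ) := {y | f y i * f y j ≠ η i * η j}

lemma auxA_meas {p n : ℕ} {f : (Fin p → Fin n → ℝ) → Fin n → ℝ} (hf : Measurable f)
    (η : Fin n → ℝ) (i j : Fin n) : MeasurableSet (auxA f η i j) := by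
  have : MeasurableSet {y | f y i * f y j = η i * η j} :=
    measurableSet_eq_fun (by fun_prop) (by fun_prop)
  exact this.compl

lemma aux_lossR_eq {n : ℕ} {a b : Fin n → ℝ} (ha : a ∈ pmOne n) (hb : b ∈ pmOne n) :
    lossR a b = n - |∑ j, a j * b j| := by
  have h1 : ∀ j, |a j - b j| = 1 - a j * b j := by
    intro j
    rcases ha j with h | h <;> rcases hb j with h' | h' <;> rw [h, h'] <;> norm_num
  have h2 : ∀ j, |a j + b j| = 1 + a j * b j := by
    intro j
    rcases ha j with h | h <;> rcases hb j with h' | h' <;> rw [h, h'] <;> norm_num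
  unfold lossR
  simp only [h1, h2, Finset.sum_sub_distrib, Finset.sum_add_distrib]
  simp only [Finset.sum_const, Finset.card_univ, Fintype.card_fin, nsmul_eq_mul, mul_one]
  rcases abs_cases (∑ j, a j * b j) with ⟨h, h'⟩ | ⟨h, h'⟩ <;> rw [h]
  · rw [min_eq_left (by linarith)]
  · rw [min_eq_right (by linarith)]; ring

lemma aux_abs_le {n : ℕ} {a b : Fin n → ℝ} (ha : a ∈ pmOne n) (hb : b ∈ pmOne n) :
    |∑ j, a j * b j| ≤ n := by
  refine (Finset.abs_sum_le_sum_abs _ _).trans ?_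
  have : ∀ j, |a j * b j| = 1 := by
    intro j
    rcases ha j with h | h <;> rcases hb j with h' | h' <;> rw [h, h'] <;> norm_num
  simp [this]

open Classical in
lemma aux_pairs {n : ℕ} {a b : Fin n → ℝ} (ha : a ∈ pmOne n) (hb : b ∈ pmOne n) :
    ∑ i, ∑ j ∈ Finset.univ.erase i, (if a i * a j ≠ b i * b j then (1 : ℝ) else 0)
      ≤ n * lossR a b := by
  have h1 : ∀ i j, (if a i * a j ≠ b i * b j then (1 : ℝ) else 0)
      = (1 - (a i * b i) * (a j * b j)) / 2 := by
    intro i j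
    rcases ha i with h | h <;> rcases hb i with h' | h' <;> rcases ha j with k | k <;>
      rcases hb j with k' | k' <;> rw [h, h', k, k'] <;> norm_num
  calc _ ≤ ∑ i, ∑ j, (if a i * a j ≠ b i * b j then (1 : ℝ) else 0) := by
        refine Finset.sum_le_sum fun i _ => ?_
        refine Finset.sum_le_sum_of_subset_of_nonneg (Finset.erase_subset _ _) ?_
        intro j _ _
        split_ifs <;> norm_num
    _ = ((n : ℝ) ^ 2 - (∑ j, a j * b j) ^ 2) / 2 := by
        simp only [h1, ← Finset.sum_div, Finset.sum_sub_distrib, ← Finset.mul_sum,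
          ← Finset.sum_mul]
        simp
        ring
    _ ≤ _ := by
        rw [aux_lossR_eq ha hb, ← sq_abs (∑ j, a j * b j)]
        have := aux_abs_le ha hb
        nlinarith [sq_nonneg ((n : ℝ) - |∑ j, a j * b j|)]

lemma aux_loss_bounds {n : ℕ} {a b : Fin n → ℝ} (ha : a ∈ pmOne n) (hb : b ∈ pmOne n) :
    0 ≤ lossR a b ∧ lossR a b ≤ n := by
  rw [aux_lossR_eq ha hb]
  have := aux_abs_le ha hb
  have := abs_nonneg (∑ j, a j * b j)
  constructor <;> linarith

lemma aux_loss_int {p n : ℕ} {σ : ℝ} {f : (Fin p → Fin n → ℝ) → Fin n → ℝ} (hf : Measurable f)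
    (hf' : ∀ y, f y ∈ pmOne n) (θ : Fin p → ℝ) {η : Fin n → ℝ} (hη : η ∈ pmOne n) :
    Integrable (fun y => lossR (f y) η) (lawY p n σ θ η) := by
  have hlp : IsProbabilityMeasure (lawY p n σ θ η) := by unfold lawY; infer_instance
  have hm : Measurable (fun y => lossR (f y) η) := by
    unfold lossR; fun_prop
  refine Integrable.of_bound hm.aestronglyMeasurable n (Filter.Eventually.of_forall fun y => ?_)
  have := aux_loss_bounds (hf' y) hη
  rw [Real.norm_eq_abs, abs_of_nonneg this.1]
  exact this.2

lemma aux_risk_bounds {p n : ℕ} {σ : ℝ} {f : (Fin p → Fin n → ℝ) → Fin n → ℝ} (hf : Measurable f)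
    (hf' : ∀ y, f y ∈ pmOne n) (θ : Fin p → ℝ) {η : Fin n → ℝ} (hη : η ∈ pmOne n) :
    0 ≤ risk p n σ f θ η ∧ risk p n σ f θ η ≤ n := by
  have hlp : IsProbabilityMeasure (lawY p n σ θ η) := by unfold lawY; infer_instance
  constructor
  · exact integral_nonneg fun y => (aux_loss_bounds (hf' y) hη).1
  · calc risk p n σ f θ η ≤ ∫ y, (n : ℝ) ∂(lawY p n σ θ η) :=
        integral_mono (aux_loss_int hf hf' θ hη) (integrable_const _)
          fun y => (aux_loss_bounds (hf' y) hη).2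
      _ = n := by simp

lemma aux_risk_pairs {p n : ℕ} {σ : ℝ} {f : (Fin p → Fin n → ℝ) → Fin n → ℝ} (hf : Measurable f)
    (hf' : ∀ y, f y ∈ pmOne n) (θ : Fin p → ℝ) {η : Fin n → ℝ} (hη : η ∈ pmOne n) :
    ∑ i, ∑ j ∈ Finset.univ.erase i, (lawY p n σ θ η).real (auxA f η i j)
      ≤ n * risk p n σ f θ η := by
  classical
  have hlp : IsProbabilityMeasure (lawY p n σ θ η) := by unfold lawY; infer_instance
  have hI : ∀ i j, Integrable ((auxA f η i j).indicator (fun _ => (1 : ℝ))) (lawY p n σ θ η) :=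
    fun i j => (integrable_const 1).indicator (auxA_meas hf η i j)
  have h1 : ∀ i j, (lawY p n σ θ η).real (auxA f η i j)
      = ∫ y, (auxA f η i j).indicator (fun _ => (1 : ℝ)) y ∂(lawY p n σ θ η) := by
    intro i j
    rw [integral_indicator_const _ (auxA_meas hf η i j)]; simp
  simp_rw [h1]
  unfold risk
  rw [← integral_const_mul]
  have h2 : ∀ i, ∑ j ∈ Finset.univ.erase i,
      ∫ y, (auxA f η i j).indicator (fun _ => (1 : ℝ)) y ∂(lawY p n σ θ η)
      = ∫ y, ∑ j ∈ Finset.univ.erase i, (auxA f η i j).indicator (fun _ => (1 : ℝ)) y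
        ∂(lawY p n σ θ η) := by
    intro i
    rw [integral_finsetSum _ fun j _ => hI i j]
  simp_rw [h2]
  rw [← integral_finsetSum _ fun i _ => integrable_finsetSum _ fun j _ => hI i j]
  refine integral_mono (integrable_finsetSum _ fun i _ => integrable_finsetSum _ fun j _ => hI i j)
    ((aux_loss_int hf hf' θ hη).const_mul _) fun y => ?_
  refine le_trans (le_of_eq ?_) (aux_pairs (hf' y) hη)
  refine Finset.sum_congr rfl fun i _ => Finset.sum_congr rfl fun j _ => ?_
  simp only [Set.indicator_apply, auxA, Set.mem_ofPred_eq]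

/-- The prior puts little mass below the threshold. -/
lemma aux_prior {p : ℕ} {Δ α : ℝ} (hΔ : 0 < Δ) (hα : 0 < α) :
    MeasurableSet {θ : Fin p → ℝ | eucNorm θ < Δ} ∧
    (gaussVec p (α ^ 2)).real {θ | eucNorm θ < Δ}
      ≤ ((gaussVec p 1) {ε | ∑ j, ε j ^ 2 ≤ Δ ^ 2 / α ^ 2}).toReal := by
  have hgp : IsProbabilityMeasure (gaussVec p 1) := by unfold gaussVec; infer_instance
  have hB : MeasurableSet {θ : Fin p → ℝ | eucNorm θ < Δ} := by
    unfold eucNorm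
    exact measurableSet_lt (by fun_prop) (by fun_prop)
  refine ⟨hB, ?_⟩
  have hmp : MeasurePreserving (fun (x : Fin p → ℝ) a => 1 * (0 + α * x a))
      (gaussVec p 1) (gaussVec p (α ^ 2)) := by
    unfold gaussVec
    refine measurePreserving_pi (fun _ : Fin p => gaussianReal 0 (1 : ℝ).toNNReal) _
      (f := fun a (x : ℝ) => 1 * (0 + α * x)) fun a => ?_
    refine ⟨by fun_prop, ?_⟩
    have := aux_gauss_map hα 0 1 (Or.inl rfl)
    rwa [zero_mul] at this
  rw [Measure.real, ← hmp.measure_preimage hB.nullMeasurableSet]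
  refine ENNReal.toReal_mono (measure_ne_top _ _) (measure_mono ?_)
  intro x hx
  simp only [Set.mem_preimage, Set.mem_ofPred_eq, eucNorm, one_mul, zero_add, mul_pow,
    ← Finset.mul_sum] at hx ⊢
  rw [Real.sqrt_lt' hΔ] at hx
  rw [le_div_iff₀ (by positivity)]
  linarith

/-- Sign vector attached to a Boolean vector. -/
def auxE {n : ℕ} (s : Fin n → Bool) : Fin n → ℝ := fun j => if s j then 1 else -1

lemma auxE_mem {n : ℕ} (s : Fin n → Bool) : auxE s ∈ pmOne n := by
  intro j
  unfold auxE
  split_ifs <;> simp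

lemma auxE_flip {n : ℕ} (s : Fin n → Bool) (i : Fin n) :
    auxE (Function.update s i (!s i)) = Function.update (auxE s) i (-auxE s i) := by
  funext j
  by_cases h : j = i
  · subst h
    cases h : s j <;> simp [auxE, h]
  · simp [auxE, Function.update_of_ne h]

lemma auxA_flip {p n : ℕ} {f : (Fin p → Fin n → ℝ) → Fin n → ℝ} (hf' : ∀ y, f y ∈ pmOne n)
    {η : Fin n → ℝ} (hη : η ∈ pmOne n) {i j : Fin n} (hij : j ≠ i) :
    auxA f (Function.update η i (-η i)) i j = (auxA f η i j)ᶜ := by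
  ext y
  simp only [auxA, Set.mem_ofPred_eq, Set.mem_compl_iff, Function.update_self,
    Function.update_of_ne hij]
  rcases hf' y i with h | h <;> rcases hf' y j with h' | h' <;> rcases hη i with k | k <;>
      rcases hη j with k' | k' <;> rw [h, h', k, k'] <;> norm_num

lemma aux_sum_flip {p m : ℕ} {σ α : ℝ} (hp : 1 ≤ p) (hm : 1 ≤ m) (hσ : 0 < σ) (hα : 0 < α)
    {f : (Fin p → Fin (m + 1) → ℝ) → Fin (m + 1) → ℝ} (hf : Measurable f)
    (hf' : ∀ y, f y ∈ pmOne (m + 1)) {i j : Fin (m + 1)} (hij : j ≠ i) :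
    2 ^ (m + 1) * ∫ θ, Gfun p (m + 1) σ 0 θ ∂(gaussVec p (α ^ 2))
      ≤ ∑ s : Fin (m + 1) → Bool, ∫ θ, (lawY p (m + 1) σ θ (auxE s)).real (auxA f (auxE s) i j)
          ∂(gaussVec p (α ^ 2)) := by
  set F : (Fin (m + 1) → Bool) → ℝ := fun s =>
    ∫ θ, (lawY p (m + 1) σ θ (auxE s)).real (auxA f (auxE s) i j) ∂(gaussVec p (α ^ 2)) with hF
  set E := ∫ θ, Gfun p (m + 1) σ 0 θ ∂(gaussVec p (α ^ 2)) with hE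
  let fl : (Fin (m + 1) → Bool) → (Fin (m + 1) → Bool) := fun s => Function.update s i (!s i)
  have hinv : Function.Involutive fl := by
    intro s
    simp [fl]
  have h1 : ∀ s, 2 * E ≤ F s + F (fl s) := by
    intro s
    have := aux_NP_real hp hm hσ hα (auxE_mem s) i (auxA_meas hf (auxE s) i j)
    simp only [hF, fl]
    rw [auxE_flip, auxA_flip hf' (auxE_mem s) hij]
    exact this
  have h2 : ∑ s, F (fl s) = ∑ s, F s := Equiv.sum_comp (hinv.toPerm) F
  have h3 : ∑ s : Fin (m + 1) → Bool, 2 * E ≤ ∑ s, (F s + F (fl s)) :=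
    Finset.sum_le_sum fun s _ => h1 s
  rw [Finset.sum_add_distrib, h2] at h3
  simp at h3
  linarith

lemma aux_main {p m : ℕ} {σ Δ α : ℝ} (hp : 1 ≤ p) (hm : 1 ≤ m) (hσ : 0 < σ) (hΔ : 0 < Δ)
    (hα : 0 < α) {f : (Fin p → Fin (m + 1) → ℝ) → Fin (m + 1) → ℝ} (hf : Measurable f)
    (hf' : ∀ y, f y ∈ pmOne (m + 1)) {M : ℝ} (hM0 : 0 ≤ M)
    (hM : ∀ θ η, Δ ≤ eucNorm θ → η ∈ pmOne (m + 1) →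
      ((m + 1 : ℕ) : ℝ)⁻¹ * risk p (m + 1) σ f θ η ≤ M) :
    1 / 2 * (∫ θ, Gfun p (m + 1) σ 0 θ ∂(gaussVec p (α ^ 2)))
          - 1 / 2 * ((gaussVec p 1) {ε | ∑ j, ε j ^ 2 ≤ Δ ^ 2 / α ^ 2}).toReal ≤ M := by
  have hgp : IsProbabilityMeasure (gaussVec p (α ^ 2)) := by unfold gaussVec; infer_instance
  have hlp : ∀ θ η, IsProbabilityMeasure (lawY p (m + 1) σ θ η) := by
    intro θ η; unfold lawY; infer_instance
  obtain ⟨hB, hP⟩ := aux_prior (p := p) hΔ hα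
  set B := {θ : Fin p → ℝ | eucNorm θ < Δ} with hBdef
  set E := ∫ θ, Gfun p (m + 1) σ 0 θ ∂(gaussVec p (α ^ 2)) with hE
  set P := ((gaussVec p 1) {ε | ∑ j, ε j ^ 2 ≤ Δ ^ 2 / α ^ 2}).toReal with hPdef
  let N : ℝ := m + 1
  have hm0 : (1 : ℝ) ≤ m := by exact_mod_cast hm
  have hI : ∀ (η : Fin (m + 1) → ℝ) i j, Integrable
      (fun θ => (lawY p (m + 1) σ θ η).real (auxA f η i j)) (gaussVec p (α ^ 2)) := by
    intro η i j
    refine Integrable.of_bound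
      (aux_swap α hσ η (auxA_meas hf η i j)).1.ennreal_toReal.aestronglyMeasurable 1
      (Filter.Eventually.of_forall fun θ => ?_)
    rw [Real.norm_eq_abs, abs_of_nonneg measureReal_nonneg]
    exact measureReal_le_one
  have hpt : ∀ η ∈ pmOne (m + 1), ∀ θ,
      ∑ i, ∑ j ∈ Finset.univ.erase i, (lawY p (m + 1) σ θ η).real (auxA f η i j)
        ≤ N ^ 2 * M + B.indicator (fun _ => N * m) θ := by
    intro η hη θ
    by_cases hθ : θ ∈ B
    · rw [Set.indicator_of_mem hθ]
      have : ∑ i : Fin (m + 1), ∑ j ∈ Finset.univ.erase i,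
          (lawY p (m + 1) σ θ η).real (auxA f η i j)
          ≤ ∑ i : Fin (m + 1), ∑ j ∈ Finset.univ.erase i, (1 : ℝ) :=
        Finset.sum_le_sum fun i _ => Finset.sum_le_sum fun j _ => measureReal_le_one
      have e : ∑ i : Fin (m + 1), ∑ j ∈ Finset.univ.erase i, (1 : ℝ) = N * m := by
        simp [N]
      have : 0 ≤ N ^ 2 * M := by positivity
      linarith
    · rw [Set.indicator_of_notMem hθ, add_zero]
      have h1 := aux_risk_pairs (σ := σ) hf hf' θ hη
      have h2 := hM θ η (not_lt.mp hθ) hη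
      have hN : (0 : ℝ) < ((m + 1 : ℕ) : ℝ) := by positivity
      rw [inv_mul_le_iff₀ hN] at h2
      have hNe : N = ((m + 1 : ℕ) : ℝ) := by simp [N]
      rw [hNe]
      refine h1.trans ((mul_le_mul_of_nonneg_left h2 hN.le).trans (le_of_eq (by ring)))
  have hint : ∀ η ∈ pmOne (m + 1),
      ∑ i, ∑ j ∈ Finset.univ.erase i,
        ∫ θ, (lawY p (m + 1) σ θ η).real (auxA f η i j) ∂(gaussVec p (α ^ 2))
        ≤ N ^ 2 * M + N * m * P := by
    intro η hη
    have e1 : ∑ i, ∑ j ∈ Finset.univ.erase i,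
        ∫ θ, (lawY p (m + 1) σ θ η).real (auxA f η i j) ∂(gaussVec p (α ^ 2))
        = ∫ θ, ∑ i, ∑ j ∈ Finset.univ.erase i, (lawY p (m + 1) σ θ η).real (auxA f η i j)
          ∂(gaussVec p (α ^ 2)) := by
      rw [integral_finsetSum _ fun i _ => integrable_finsetSum _ fun j _ => hI η i j]
      refine Finset.sum_congr rfl fun i _ => ?_
      rw [integral_finsetSum _ fun j _ => hI η i j]
    have hind : Integrable (B.indicator (fun _ => N * (m : ℝ))) (gaussVec p (α ^ 2)) :=
      (integrable_const _).indicator hB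
    rw [e1]
    calc _ ≤ ∫ θ, (N ^ 2 * M + B.indicator (fun _ => N * (m : ℝ)) θ) ∂(gaussVec p (α ^ 2)) :=
          integral_mono (integrable_finsetSum _ fun i _ => integrable_finsetSum _
            fun j _ => hI η i j) ((integrable_const _).add hind) (hpt η hη)
      _ = N ^ 2 * M + (gaussVec p (α ^ 2)).real B * (N * m) := by
          rw [integral_add (integrable_const _) hind, integral_indicator_const _ hB]
          simp
      _ ≤ _ := by
          have : 0 ≤ N * (m : ℝ) := by positivity
          nlinarith
  have htot : ∑ s : Fin (m + 1) → Bool, ∑ i, ∑ j ∈ Finset.univ.erase i,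
      ∫ θ, (lawY p (m + 1) σ θ (auxE s)).real (auxA f (auxE s) i j) ∂(gaussVec p (α ^ 2))
        ≤ 2 ^ (m + 1) * (N ^ 2 * M + N * m * P) := by
    refine (Finset.sum_le_sum fun s _ => hint (auxE s) (auxE_mem s)).trans (le_of_eq ?_)
    simp
    ring
  have hlow : 2 ^ (m + 1) * (N * m * E) ≤ ∑ s : Fin (m + 1) → Bool, ∑ i,
      ∑ j ∈ Finset.univ.erase i,
      ∫ θ, (lawY p (m + 1) σ θ (auxE s)).real (auxA f (auxE s) i j) ∂(gaussVec p (α ^ 2)) := by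
    rw [Finset.sum_comm]
    have : ∀ i : Fin (m + 1), (m : ℝ) * (2 ^ (m + 1) * E) ≤ ∑ s : Fin (m + 1) → Bool,
        ∑ j ∈ Finset.univ.erase i,
        ∫ θ, (lawY p (m + 1) σ θ (auxE s)).real (auxA f (auxE s) i j)
          ∂(gaussVec p (α ^ 2)) := by
      intro i
      rw [Finset.sum_comm]
      refine le_trans (le_of_eq ?_) (Finset.sum_le_sum fun j hj =>
        aux_sum_flip (σ := σ) (α := α) hp hm hσ hα hf hf' (Finset.ne_of_mem_erase hj))
      simp [hE]
    refine le_trans (le_of_eq ?_) (Finset.sum_le_sum fun i _ => this i)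
    simp [N]
    ring
  have h := hlow.trans htot
  have h' : N * m * E ≤ N ^ 2 * M + N * m * P := le_of_mul_le_mul_left h (by positivity)
  have hNpos : 0 < N := by positivity
  have h'' : m * (E - P) ≤ N * M := by
    refine le_of_mul_le_mul_left ?_ hNpos
    nlinarith
  have hN2 : N ≤ 2 * m := by simp only [N]; linarith
  by_contra hcon
  push Not at hcon
  have : N * M ≤ 2 * m * M := mul_le_mul_of_nonneg_right hN2 hM0
  nlinarith

/-- Proposition 3: `Ψ_Δ ≥ c 𝔼_{π^α_θ} G_σ(0,θ) - c P(Σ_j ε_j² ≤ Δ²/α²)`. -/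
theorem statement3 :
    ∃ c : ℝ, 0 < c ∧ ∀ (n p : ℕ) (σ Δ α : ℝ), 2 ≤ n → 1 ≤ p → 0 < σ → 0 < Δ → 0 < α →
      c * (∫ θ, Gfun p n σ 0 θ ∂(gaussVec p (α ^ 2)))
          - c * ((gaussVec p 1) {ε | ∑ j, ε j ^ 2 ≤ Δ ^ 2 / α ^ 2}).toReal
        ≤ minimaxRisk p n σ Δ := by
  refine ⟨1 / 2, by norm_num, ?_⟩
  intro n p σ Δ α hn hp hσ hΔ hα
  obtain ⟨m, rfl⟩ : ∃ m, n = m + 1 := ⟨n - 1, by omega⟩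
  have hm : 1 ≤ m := by omega
  have hne : Nonempty {f : (Fin p → Fin (m + 1) → ℝ) → Fin (m + 1) → ℝ //
      Measurable f ∧ ∀ y, f y ∈ pmOne (m + 1)} :=
    ⟨⟨fun _ _ => 1, measurable_const, fun _ _ => Or.inl rfl⟩⟩
  unfold _root_.minimaxRisk
  refine le_ciInf fun f => ?_
  obtain ⟨f, hf, hf'⟩ := f
  have hN : (0 : ℝ) < ((m + 1 : ℕ) : ℝ) := by positivity
  have hbdd : BddAbove (Set.range fun x : Omega p (m + 1) Δ =>
      ((m + 1 : ℕ) : ℝ)⁻¹ * risk p (m + 1) σ f x.1.1 x.1.2) := by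
    refine ⟨1, ?_⟩
    rintro _ ⟨x, rfl⟩
    have := (aux_risk_bounds (σ := σ) hf hf' x.1.1 x.2.2).2
    simp only
    rw [inv_mul_le_iff₀ hN, mul_one]
    exact this
  refine aux_main hp hm hσ hΔ hα hf hf' ?_ ?_
  · refine Real.iSup_nonneg fun x => ?_
    have := (aux_risk_bounds (σ := σ) hf hf' x.1.1 x.2.2).1
    positivity
  · intro θ η hθ hη
    exact le_ciSup hbdd (⟨(θ, η), hθ, hη⟩ : Omega p (m + 1) Δ)

end
end

section
/- There exists an absolute constant c > 0 such that for every choice of sequences p_n ≥ 1, σ_n > 0, Δ_n > 0 there exist a sequence ε_n → 0 and N ∈ ℕ such that for all n ≥ N, Ψ_{Δ_n} ≥ c · Φ^c( r_n (1 + ε_n) ). -/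
open MeasureTheory ProbabilityTheory Filter Finset Asymptotics
open scoped ENNReal

noncomputable section

/-- standard Gaussian on `Fin p → ℝ`. -/
abbrev G1 (p : ℕ) : Measure (Fin p → ℝ) := Measure.pi fun _ => gaussianReal 0 1

/-- standard Gaussian on matrices. -/
abbrev GW (p n : ℕ) : Measure (Fin p → Fin n → ℝ) := Measure.pi fun _ => G1 n

lemma charlin_aux (a : ℝ) :
    ∫ z, Complex.exp (Complex.I * ((a * z : ℝ) : ℂ)) ∂(gaussianReal 0 1)
      = Complex.exp (((-(a ^ 2) / 2 : ℝ) : ℂ)) := by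
  have h := charFun_gaussianReal (μ := 0) (v := 1) a
  rw [charFun_apply_real] at h
  have e : ∀ z : ℝ, Complex.exp (Complex.I * ((a * z : ℝ) : ℂ))
      = Complex.exp ((a:ℂ) * z * Complex.I) := by
    intro z; congr 1; push_cast; ring
  simp_rw [e]
  rw [h]
  congr 1; push_cast; simp; ring

lemma charlin {p : ℕ} (a : Fin p → ℝ) :
    ∫ z, Complex.exp (Complex.I * ((∑ i, a i * z i : ℝ) : ℂ)) ∂(G1 p)
      = Complex.exp (((-(∑ i, a i ^ 2) / 2 : ℝ) : ℂ)) := by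
  have e : ∀ z : Fin p → ℝ, Complex.exp (Complex.I * ((∑ i, a i * z i : ℝ) : ℂ))
      = ∏ i, Complex.exp (Complex.I * ((a i * z i : ℝ) : ℂ)) := by
    intro z
    rw [← Complex.exp_sum, ← Finset.mul_sum]; push_cast; rfl
  simp_rw [e]
  rw [integral_fintype_prod_eq_prod (fun i (x : ℝ) => Complex.exp (Complex.I * ((a i * x : ℝ) : ℂ)))]
  simp_rw [charlin_aux]
  rw [← Complex.exp_sum]
  congr 1
  rw [← Complex.ofReal_sum]
  congr 1
  rw [← Finset.sum_div, Finset.sum_neg_distrib]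

lemma charlinW {p n : ℕ} (a : Fin p → Fin n → ℝ) :
    ∫ z, Complex.exp (Complex.I * ((∑ i, ∑ k, a i k * z i k : ℝ) : ℂ)) ∂(GW p n)
      = Complex.exp (((-(∑ i, ∑ k, a i k ^ 2) / 2 : ℝ) : ℂ)) := by
  have e : ∀ z : Fin p → Fin n → ℝ, Complex.exp (Complex.I * ((∑ i, ∑ k, a i k * z i k : ℝ) : ℂ))
      = ∏ i, Complex.exp (Complex.I * ((∑ k, a i k * z i k : ℝ) : ℂ)) := by
    intro z
    rw [← Complex.exp_sum, ← Finset.mul_sum]; push_cast; rfl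
  simp_rw [e]
  rw [integral_fintype_prod_eq_prod
    (fun i (x : Fin n → ℝ) => Complex.exp (Complex.I * ((∑ k, a i k * x k : ℝ) : ℂ)))]
  simp_rw [charlin]
  rw [← Complex.exp_sum]
  congr 1
  rw [← Complex.ofReal_sum]
  congr 1
  rw [← Finset.sum_div, Finset.sum_neg_distrib]

lemma map_lin {p : ℕ} (a : Fin p → ℝ) :
    (G1 p).map (fun z => ∑ i, a i * z i) = gaussianReal 0 (∑ i, a i ^ 2).toNNReal := by
  have hm : Measurable (fun z : Fin p → ℝ => ∑ i, a i * z i) := by fun_prop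
  have : IsProbabilityMeasure ((G1 p).map (fun z => ∑ i, a i * z i)) :=
    Measure.isProbabilityMeasure_map hm.aemeasurable
  apply Measure.ext_of_charFun
  ext t
  rw [charFun_gaussianReal, charFun_apply_real, integral_map hm.aemeasurable (by fun_prop)]
  have h := charlin (fun i => t * a i)
  have e : ∀ z : Fin p → ℝ, Complex.exp ((t:ℂ) * ((∑ i, a i * z i : ℝ) : ℂ) * Complex.I)
     = Complex.exp (Complex.I * ((∑ i, (t * a i) * z i : ℝ) : ℂ)) := by
    intro z; congr 1
    simp_rw [mul_assoc]
    rw [← Finset.mul_sum]; push_cast; ring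
  simp_rw [e]
  rw [h]
  congr 1
  have : (0:ℝ) ≤ ∑ i, a i ^ 2 := Finset.sum_nonneg (fun _ _ => sq_nonneg _)
  rw [Real.coe_toNNReal _ this]
  simp_rw [mul_pow]
  rw [← Finset.mul_sum]
  push_cast; ring

lemma shift1 (m : ℝ) : (gaussianReal 0 1).map (fun x => x + m)
    = (gaussianReal 0 1).withDensity (fun x => ENNReal.ofReal (Real.exp (m * x - m ^ 2 / 2))) := by
  rw [gaussianReal_map_add_const, gaussianReal_of_var_ne_zero _ one_ne_zero,
    gaussianReal_of_var_ne_zero _ one_ne_zero, ← withDensity_mul _ (measurable_gaussianPDF _ _)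
      (by fun_prop)]
  congr 1
  ext x
  simp only [Pi.mul_apply, gaussianPDF, gaussianPDFReal]
  rw [← ENNReal.ofReal_mul (by positivity), mul_assoc (_)⁻¹, ← Real.exp_add]
  congr 3
  simp; ring

lemma shift_pi {p : ℕ} (m : Fin p → ℝ) : (G1 p).map (fun x i => x i + m i)
    = (G1 p).withDensity
      (fun x => ENNReal.ofReal (Real.exp (∑ i, m i * x i - (∑ i, m i ^ 2) / 2))) := by
  have : ∀ i, IsProbabilityMeasure ((gaussianReal 0 1).map (fun x => x + m i)) := fun i =>
    Measure.isProbabilityMeasure_map (by fun_prop)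
  rw [Measure.pi_map_pi (f := fun i x => x + m i) (fun i => by fun_prop)]
  refine Measure.pi_eq fun s hs => ?_
  rw [withDensity_apply _ (MeasurableSet.univ_pi hs), ← lintegral_indicator (MeasurableSet.univ_pi hs)]
  have e : ∀ x : Fin p → ℝ, (Set.univ.pi s).indicator
      (fun x => ENNReal.ofReal (Real.exp (∑ i, m i * x i - (∑ i, m i ^ 2) / 2))) x
      = ENNReal.ofReal (∏ i, (s i).indicator (fun x => Real.exp (m i * x - m i ^ 2 / 2)) (x i)) := by
    intro x
    by_cases hx : x ∈ Set.univ.pi s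
    · rw [Set.indicator_of_mem hx]
      congr 1
      rw [Finset.prod_congr rfl (fun i _ => Set.indicator_of_mem (hx i trivial) _),
        ← Real.exp_sum, Finset.sum_sub_distrib, Finset.sum_div]
    · rw [Set.indicator_of_notMem hx]
      have : ∃ i, x i ∉ s i := by
        by_contra hcon; push Not at hcon; exact hx fun i _ => hcon i
      obtain ⟨i, hi⟩ := this
      rw [Finset.prod_eq_zero (Finset.mem_univ i) (Set.indicator_of_notMem hi _)]; simp
  have hIntg : ∀ i, Integrable ((s i).indicator (fun x => Real.exp (m i * x - m i ^ 2 / 2)))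
      (gaussianReal 0 1) := by
    intro i
    refine Integrable.indicator ?_ (hs i)
    simp_rw [Real.exp_sub]
    exact (integrable_exp_mul_gaussianReal (m i)).div_const _
  have hnn : ∀ i x, 0 ≤ (s i).indicator (fun x => Real.exp (m i * x - m i ^ 2 / 2)) x :=
    fun i x => Set.indicator_nonneg (fun _ _ => (Real.exp_pos _).le) _
  simp_rw [e]
  rw [← ofReal_integral_eq_lintegral_ofReal (Integrable.fintype_prod hIntg)
    (Filter.Eventually.of_forall fun x => Finset.prod_nonneg fun i _ => hnn i _),
    integral_fintype_prod_eq_prod, ENNReal.ofReal_prod_of_nonneg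
      (fun i _ => integral_nonneg (hnn i))]
  refine Finset.prod_congr rfl fun i _ => ?_
  rw [shift1, withDensity_apply _ (hs i), ← lintegral_indicator (hs i),
    ofReal_integral_eq_lintegral_ofReal (hIntg i) (Filter.Eventually.of_forall (hnn i))]
  refine lintegral_congr fun x => ?_
  by_cases hx : x ∈ s i <;> simp [hx]


lemma Phic_anti : Antitone Phic := by
  intro a b hab
  unfold Phic
  apply ENNReal.toReal_mono (measure_ne_top _ _)
  apply measure_mono
  intro x hx
  exact lt_of_le_of_lt hab hx

lemma Phic_le_one (t : ℝ) : Phic t ≤ 1 := measureReal_le_one (μ := gaussianReal 0 1)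

lemma Phic_nonneg (t : ℝ) : 0 ≤ Phic t := ENNReal.toReal_nonneg

lemma Phic_symm (t : ℝ) : (gaussianReal 0 1).real {x | x < -t} = Phic t := by
  unfold Phic
  have h := gaussianReal_map_neg (μ := 0) (v := 1)
  rw [neg_zero] at h
  rw [measureReal_def]
  conv_rhs => rw [← h]
  rw [Measure.map_apply (by fun_prop) (measurableSet_lt (by fun_prop) (by fun_prop))]
  congr 2
  ext x
  simp only [Set.mem_ofPred_eq, Set.mem_preimage]
  constructor <;> intro h <;> linarith

lemma phi_anti {a b : ℝ} (ha : 0 ≤ a) (hab : a ≤ b) :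
    gaussianPDFReal 0 1 b ≤ gaussianPDFReal 0 1 a := by
  simp only [gaussianPDFReal]
  gcongr

lemma Phic_sub {a b : ℝ} (hab : a ≤ b) :
    Phic a - Phic b = ∫ x in Set.Ioc a b, gaussianPDFReal 0 1 x := by
  have h1 : (gaussianReal 0 1).real (Set.Ioi a)
     = (gaussianReal 0 1).real (Set.Ioc a b) + (gaussianReal 0 1).real (Set.Ioi b) := by
    rw [← measureReal_union (Set.Ioc_disjoint_Ioi le_rfl) measurableSet_Ioi,
      Set.Ioc_union_Ioi_eq_Ioi hab]
  have h2 : (gaussianReal 0 1).real (Set.Ioc a b) = ∫ x in Set.Ioc a b, gaussianPDFReal 0 1 x := by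
    rw [measureReal_def, gaussianReal_apply_eq_integral _ one_ne_zero, ENNReal.toReal_ofReal]
    exact integral_nonneg fun x => gaussianPDFReal_nonneg _ _ _
  change (gaussianReal 0 1).real (Set.Ioi a) - (gaussianReal 0 1).real (Set.Ioi b) = _
  rw [← h2]; linarith

lemma Phic_sub_le {a b : ℝ} (ha : 0 ≤ a) (hab : a ≤ b) :
    Phic a - Phic b ≤ gaussianPDFReal 0 1 a * (b - a) := by
  rw [Phic_sub hab]
  have : ∫ x in Set.Ioc a b, gaussianPDFReal 0 1 a = gaussianPDFReal 0 1 a * (b - a) := by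
    simp [measureReal_def, ENNReal.toReal_ofReal (sub_nonneg.2 hab), mul_comm]
  rw [← this]
  refine setIntegral_mono_on (integrable_gaussianPDFReal _ _).integrableOn (by simp) measurableSet_Ioc ?_
  intro x hx
  exact phi_anti ha hx.1.le

lemma le_Phic_sub {a b : ℝ} (ha : 0 ≤ a) (hab : a ≤ b) :
    gaussianPDFReal 0 1 b * (b - a) ≤ Phic a - Phic b := by
  rw [Phic_sub hab]
  have : ∫ x in Set.Ioc a b, gaussianPDFReal 0 1 b = gaussianPDFReal 0 1 b * (b - a) := by
    simp [measureReal_def, ENNReal.toReal_ofReal (sub_nonneg.2 hab), mul_comm]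
  rw [← this]
  refine setIntegral_mono_on (by simp) (integrable_gaussianPDFReal _ _).integrableOn measurableSet_Ioc ?_
  intro x hx
  exact phi_anti (ha.trans hx.1.le) hx.2

lemma Phic_tangent {t t0 : ℝ} (ht : 0 ≤ t) (ht0 : 0 ≤ t0) :
    Phic t0 - gaussianPDFReal 0 1 t0 * (t - t0) ≤ Phic t := by
  rcases le_total t0 t with h | h
  · have := Phic_sub_le ht0 h; linarith
  · have := le_Phic_sub ht h; linarith

/-- quadratic version of the tangent bound -/
lemma Phic_tangent_sq {q t0 : ℝ} (hq : 0 ≤ q) (ht0 : 0 < t0) :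
    Phic t0 - gaussianPDFReal 0 1 t0 / (2 * t0) * (q - t0 ^ 2) ≤ Phic (Real.sqrt q) := by
  refine le_trans ?_ (Phic_tangent (Real.sqrt_nonneg q) ht0.le)
  have h1 : Real.sqrt q - t0 ≤ (q - t0 ^ 2) / (2 * t0) := by
    rw [le_div_iff₀ (by positivity)]
    nlinarith [sq_nonneg (Real.sqrt q - t0), Real.sq_sqrt hq]
  have := mul_le_mul_of_nonneg_left h1 (gaussianPDFReal_nonneg 0 1 t0)
  calc _ = Phic t0 - gaussianPDFReal 0 1 t0 * ((q - t0 ^ 2) / (2 * t0)) := by ring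
    _ ≤ _ := by linarith

lemma Phic_lower {t : ℝ} (ht : 0 ≤ t) :
    (Real.sqrt (2 * Real.pi))⁻¹ * Real.exp (-1) * Real.exp (-t ^ 2) ≤ Phic t := by
  have h := le_Phic_sub ht (le_add_of_nonneg_right zero_le_one : t ≤ t + 1)
  have h2 := Phic_nonneg (t + 1)
  refine le_trans ?_ (by linarith : gaussianPDFReal 0 1 (t+1) * (t + 1 - t) ≤ Phic t)
  simp only [gaussianPDFReal, add_sub_cancel_left, mul_one, mul_assoc, ← Real.exp_add]
  simp only [NNReal.coe_one, mul_one]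
  gcongr
  nlinarith [sq_nonneg (t - 1)]

lemma Phic_pos (t : ℝ) : 0 < Phic t := by
  refine lt_of_lt_of_le ?_ (Phic_anti (le_max_left t 0))
  refine lt_of_lt_of_le ?_ (Phic_lower (le_max_right t 0))
  positivity

lemma NP {p : ℕ} (m : Fin p → ℝ) {A : Set (Fin p → ℝ)} (hA : MeasurableSet A) :
    2 * Phic (Real.sqrt (∑ i, m i ^ 2)) ≤
      (G1 p).real {h | (fun i => h i + m i) ∈ A} + (G1 p).real {h | (fun i => h i - m i) ∈ Aᶜ} := by
  set q := ∑ i, m i ^ 2 with hq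
  have hq0 : 0 ≤ q := Finset.sum_nonneg (fun _ _ => sq_nonneg _)
  have key : ∀ B : Set (Fin p → ℝ), MeasurableSet B →
      (G1 p) {h | (fun i => h i + m i) ∈ B} + (G1 p) {h | (fun i => h i - m i) ∈ Bᶜ}
       = ∫⁻ x, (B.indicator (fun x => ENNReal.ofReal (Real.exp (∑ i, m i * x i - q / 2))) x
          + Bᶜ.indicator (fun x => ENNReal.ofReal (Real.exp (-∑ i, m i * x i - q / 2))) x) ∂(G1 p) := by
    intro B hB
    rw [lintegral_add_left (by exact Measurable.indicator (by fun_prop) hB),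
      lintegral_indicator hB, lintegral_indicator hB.compl]
    congr 1
    · rw [← withDensity_apply _ hB, ← shift_pi, Measure.map_apply (by fun_prop) hB]; rfl
    · have := shift_pi (fun i => - m i)
      simp only [neg_mul, Finset.sum_neg_distrib, even_two, Even.neg_pow] at this
      rw [← withDensity_apply _ hB.compl, ← this, Measure.map_apply (by fun_prop) hB.compl]; rfl
  let S : Set (Fin p → ℝ) := {x | ∑ i, m i * x i < 0}
  have hS : MeasurableSet S := measurableSet_lt (by fun_prop) (by fun_prop)
  have hle : (G1 p) {h | (fun i => h i + m i) ∈ S} + (G1 p) {h | (fun i => h i - m i) ∈ Sᶜ}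
      ≤ (G1 p) {h | (fun i => h i + m i) ∈ A} + (G1 p) {h | (fun i => h i - m i) ∈ Aᶜ} := by
    rw [key S hS, key A hA]
    refine lintegral_mono fun x => ?_
    by_cases h1 : x ∈ S <;> by_cases h2 : x ∈ A <;> simp only [h1, h2, Set.mem_compl_iff,
      Set.indicator_of_mem, Set.indicator_of_notMem, not_true_eq_false, not_false_eq_true,
      add_zero, zero_add, le_refl]
    · apply ENNReal.ofReal_le_ofReal
      have : ∑ i, m i * x i < 0 := h1
      gcongr; linarith
    · apply ENNReal.ofReal_le_ofReal
      have : ¬ ∑ i, m i * x i < 0 := h1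
      gcongr; linarith
  have hle' := ENNReal.toReal_mono (by finiteness) hle
  rw [ENNReal.toReal_add (by finiteness) (by finiteness),
    ENNReal.toReal_add (by finiteness) (by finiteness)] at hle'
  refine le_trans ?_ hle'
  have hmeas : Measurable (fun z : Fin p → ℝ => ∑ i, m i * z i) := by fun_prop
  have hml := map_lin m
  rw [← hq] at hml
  have e1 : (G1 p) {h | (fun i => h i + m i) ∈ S} = gaussianReal 0 q.toNNReal (Set.Iio (-q)) := by
    rw [← hml, Measure.map_apply hmeas measurableSet_Iio]
    congr 1; ext h
    simp only [S, Set.mem_ofPred_eq, Set.mem_preimage, Set.mem_Iio, mul_add, Finset.sum_add_distrib,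
      ← pow_two, ← hq]
    constructor <;> intro h <;> linarith
  have e2 : (G1 p) {h | (fun i => h i - m i) ∈ Sᶜ} = gaussianReal 0 q.toNNReal (Set.Ici q) := by
    rw [← hml, Measure.map_apply hmeas measurableSet_Ici]
    congr 1; ext h
    simp only [S, Set.mem_compl_iff, Set.mem_ofPred_eq, Set.mem_preimage, Set.mem_Ici, mul_sub,
      Finset.sum_sub_distrib, ← pow_two, ← hq]
    constructor <;> intro h <;> linarith
  rw [e1, e2]
  rcases hq0.eq_or_lt with h0 | hpos
  · rw [← h0]
    simp only [neg_zero, Real.toNNReal_zero, gaussianReal_zero_var, Real.sqrt_zero]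
    rw [Measure.dirac_apply' _ measurableSet_Iio, Measure.dirac_apply' _ measurableSet_Ici]
    simp only [Set.mem_Iio, lt_self_iff_false, not_false_eq_true, Set.indicator_of_notMem,
      ENNReal.toReal_zero, Set.mem_Ici, le_refl, Set.indicator_of_mem, Pi.one_apply,
      ENNReal.toReal_one, zero_add]
    have h1 := Phic_symm 0
    rw [neg_zero] at h1
    have h2 : (gaussianReal 0 1).real (Set.Iio 0 ∪ Set.Ioi 0)
        = (gaussianReal 0 1).real (Set.Iio (0:ℝ)) + (gaussianReal 0 1).real (Set.Ioi 0) :=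
      measureReal_union (by rw [Set.disjoint_left]; intro x hx hy; rw [Set.mem_Iio] at hx; rw [Set.mem_Ioi] at hy; linarith) measurableSet_Ioi
    have h3 : (gaussianReal 0 1).real (Set.Iio (0:ℝ) ∪ Set.Ioi 0) ≤ 1 := measureReal_le_one
    have h4 : (gaussianReal 0 1).real (Set.Ioi (0:ℝ)) = Phic 0 := rfl
    have h5 : (gaussianReal 0 1).real (Set.Iio (0:ℝ)) = Phic 0 := h1
    linarith
  · have hs := Real.sqrt_pos.2 hpos
    have hss := Real.mul_self_sqrt hq0
    have hg : gaussianReal 0 q.toNNReal = (gaussianReal 0 1).map (fun x => Real.sqrt q * x) := by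
      rw [gaussianReal_map_const_mul]
      congr 1
      · simp
      · ext; simp [Real.sq_sqrt hq0, hq0]
    have e3 : (gaussianReal 0 q.toNNReal) (Set.Iio (-q)) = gaussianReal 0 1 {x | x < -Real.sqrt q} := by
      rw [hg, Measure.map_apply (by fun_prop) measurableSet_Iio]
      congr 1; ext x
      simp only [Set.mem_preimage, Set.mem_Iio, Set.mem_ofPred_eq]
      constructor <;> intro h <;> nlinarith
    have e4 : gaussianReal 0 1 {x | Real.sqrt q < x} ≤ (gaussianReal 0 q.toNNReal) (Set.Ici q) := by
      rw [hg, Measure.map_apply (by fun_prop) measurableSet_Ici]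
      apply measure_mono
      intro x hx
      simp only [Set.mem_preimage, Set.mem_Ici, Set.mem_ofPred_eq] at hx ⊢
      nlinarith
    have e5 := ENNReal.toReal_mono (by finiteness) e4
    have e6 := Phic_symm (Real.sqrt q)
    rw [measureReal_def] at e6
    rw [e3, e6]
    have e7 : (gaussianReal 0 1 {x | Real.sqrt q < x}).toReal = Phic (Real.sqrt q) := rfl
    linarith


/-- the model with a Gaussian prior `θ = θ0 + τ g`. -/
def Forig {p n : ℕ} (θ0 : Fin p → ℝ) (τ σ : ℝ) (η : Fin n → ℝ)
    (z : (Fin p → ℝ) × (Fin p → Fin n → ℝ)) : Fin p → Fin n → ℝ :=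
  fun i k => (θ0 i + τ * z.1 i) * η k + σ * z.2 i k

/-- the posterior weight -/
def alp (n : ℕ) (τ σ : ℝ) : ℝ := τ ^ 2 / (((n : ℝ) - 1) * τ ^ 2 + σ ^ 2)

/-- predictive variance -/
def ssq (n : ℕ) (τ σ : ℝ) : ℝ := σ ^ 2 + τ ^ 2 * (1 - ((n : ℝ) - 1) * alp n τ σ)

/-- the sum over columns different from `j` -/
def Ufun {p n : ℕ} (τ σ : ℝ) (d : Fin n → ℝ)
    (z : (Fin p → ℝ) × (Fin p → Fin n → ℝ)) (i : Fin p) : ℝ :=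
  ((n : ℝ) - 1) * τ * z.1 i + σ * ∑ k, d k * z.2 i k

/-- off `j` labels -/
def dj {n : ℕ} (η : Fin n → ℝ) (j : Fin n) : Fin n → ℝ := fun k => if k = j then 0 else η k

/-- the same model, generated in the predictive order. -/
def Fnew {p n : ℕ} (θ0 : Fin p → ℝ) (τ σ : ℝ) (η : Fin n → ℝ) (j : Fin n)
    (z : (Fin p → ℝ) × (Fin p → ℝ) × (Fin p → Fin n → ℝ)) : Fin p → Fin n → ℝ :=
  fun i k => if k = j then
      η j * (θ0 i + alp n τ σ * Ufun τ σ (dj η j) z.2 i) + Real.sqrt (ssq n τ σ) * z.1 i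
    else (θ0 i + τ * z.2.1 i) * η k + σ * z.2.2 i k

lemma measurable_Forig {p n : ℕ} (θ0 : Fin p → ℝ) (τ σ : ℝ) (η : Fin n → ℝ) :
    Measurable (Forig (p := p) θ0 τ σ η) := by
  unfold Forig; fun_prop

lemma measurable_Fnew {p n : ℕ} (θ0 : Fin p → ℝ) (τ σ : ℝ) (η : Fin n → ℝ) (j : Fin n) :
    Measurable (Fnew (p := p) θ0 τ σ η j) := by
  unfold Fnew Ufun
  refine measurable_pi_lambda _ fun i => measurable_pi_lambda _ fun k => ?_
  by_cases h : k = j <;> simp only [h, if_true, if_false] <;> fun_prop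

lemma char2 {p n : ℕ} (κ : ℝ) (a : Fin p → ℝ) (b : Fin p → Fin n → ℝ) :
    ∫ z, Complex.exp (Complex.I *
      ((κ + ∑ i, a i * z.1 i + ∑ i, ∑ k, b i k * z.2 i k : ℝ) : ℂ)) ∂((G1 p).prod (GW p n))
      = Complex.exp (Complex.I * κ) *
        Complex.exp (((-(∑ i, (a i ^ 2 + ∑ k, b i k ^ 2)) / 2 : ℝ) : ℂ)) := by
  have e : ∀ z : (Fin p → ℝ) × (Fin p → Fin n → ℝ), Complex.exp (Complex.I *
      ((κ + ∑ i, a i * z.1 i + ∑ i, ∑ k, b i k * z.2 i k : ℝ) : ℂ))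
      = Complex.exp (Complex.I * κ) * (Complex.exp (Complex.I * ((∑ i, a i * z.1 i : ℝ) : ℂ)) *
        Complex.exp (Complex.I * ((∑ i, ∑ k, b i k * z.2 i k : ℝ) : ℂ))) := by
    intro z
    rw [← Complex.exp_add, ← Complex.exp_add]; congr 1; push_cast; ring
  simp_rw [e]
  rw [integral_const_mul, integral_prod_mul
    (fun x : Fin p → ℝ => Complex.exp (Complex.I * ((∑ i, a i * x i : ℝ) : ℂ)))
    (fun x : Fin p → Fin n → ℝ => Complex.exp (Complex.I * ((∑ i, ∑ k, b i k * x i k : ℝ) : ℂ))),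
    charlin, charlinW, ← Complex.exp_add]
  congr 2
  rw [Finset.sum_add_distrib]; push_cast; ring

lemma char3 {p n : ℕ} (κ : ℝ) (c a : Fin p → ℝ) (b : Fin p → Fin n → ℝ) :
    ∫ z, Complex.exp (Complex.I *
      ((∑ i, c i * z.1 i + (κ + ∑ i, a i * z.2.1 i + ∑ i, ∑ k, b i k * z.2.2 i k) : ℝ) : ℂ))
        ∂((G1 p).prod ((G1 p).prod (GW p n)))
      = Complex.exp (Complex.I * κ) *
        Complex.exp (((-(∑ i, (c i ^ 2 + a i ^ 2 + ∑ k, b i k ^ 2)) / 2 : ℝ) : ℂ)) := by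
  have e : ∀ z : (Fin p → ℝ) × (Fin p → ℝ) × (Fin p → Fin n → ℝ), Complex.exp (Complex.I *
      ((∑ i, c i * z.1 i + (κ + ∑ i, a i * z.2.1 i + ∑ i, ∑ k, b i k * z.2.2 i k) : ℝ) : ℂ))
      = Complex.exp (Complex.I * ((∑ i, c i * z.1 i : ℝ) : ℂ)) *
        Complex.exp (Complex.I *
          ((κ + ∑ i, a i * z.2.1 i + ∑ i, ∑ k, b i k * z.2.2 i k : ℝ) : ℂ)) := by
    intro z
    rw [← Complex.exp_add]; congr 1; push_cast; ring
  simp_rw [e]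
  rw [integral_prod_mul
    (fun x : Fin p → ℝ => Complex.exp (Complex.I * ((∑ i, c i * x i : ℝ) : ℂ)))
    (fun x : (Fin p → ℝ) × (Fin p → Fin n → ℝ) => Complex.exp (Complex.I *
          ((κ + ∑ i, a i * x.1 i + ∑ i, ∑ k, b i k * x.2 i k : ℝ) : ℂ))),
    charlin, char2, mul_left_comm, ← Complex.exp_add]
  congr 2
  simp_rw [Finset.sum_add_distrib]; push_cast; ring

lemma dual_expand {p n : ℕ} (L : StrongDual ℝ (Fin p → Fin n → ℝ)) :
    ∃ c : Fin p → Fin n → ℝ, ∀ y, L y = ∑ i, ∑ k, c i k * y i k := by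
  refine ⟨fun i k => L (Pi.single i (Pi.single k 1)), fun y => ?_⟩
  have hy : y = ∑ i, ∑ k, y i k • (Pi.single i (Pi.single k 1) : Fin p → Fin n → ℝ) := by
    ext a b
    simp only [Finset.sum_apply, Pi.smul_apply, smul_eq_mul]
    rw [Finset.sum_eq_single a, Finset.sum_eq_single b]
    · simp
    · intro k _ hk; simp [Ne.symm hk]
    · simp
    · intro i _ hi
      refine Finset.sum_eq_zero fun k _ => ?_
      rw [Pi.single_eq_of_ne (Ne.symm hi)]; simp
    · simp
  conv_lhs => rw [hy]
  simp only [map_sum, map_smul, smul_eq_mul]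
  simp_rw [mul_comm]

lemma alp_mul {n : ℕ} (hn : 2 ≤ n) (τ : ℝ) {σ : ℝ} (hσ : 0 < σ) :
    alp n τ σ * (((n : ℝ) - 1) * τ ^ 2 + σ ^ 2) = τ ^ 2 := by
  have : (2:ℝ) ≤ n := by exact_mod_cast hn
  have h2 : (0:ℝ) < ((n : ℝ) - 1) * τ ^ 2 + σ ^ 2 := by
    have : 0 ≤ ((n : ℝ) - 1) * τ ^ 2 := mul_nonneg (by linarith) (sq_nonneg _)
    positivity
  unfold alp
  exact div_mul_cancel₀ _ h2.ne'

lemma ssq_ge {n : ℕ} (hn : 2 ≤ n) (τ : ℝ) {σ : ℝ} (hσ : 0 < σ) : σ ^ 2 ≤ ssq n τ σ := by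
  have h0 : (2:ℝ) ≤ n := by exact_mod_cast hn
  have h2 : (0:ℝ) < ((n : ℝ) - 1) * τ ^ 2 + σ ^ 2 := by
    have : 0 ≤ ((n : ℝ) - 1) * τ ^ 2 := mul_nonneg (by linarith) (sq_nonneg _)
    positivity
  have h3 : ((n : ℝ) - 1) * alp n τ σ ≤ 1 := by
    unfold alp
    rw [← mul_div_assoc, div_le_one h2]
    nlinarith [sq_nonneg σ]
  unfold ssq
  nlinarith [mul_nonneg (sq_nonneg τ) (sub_nonneg.2 h3)]

lemma sum_dj_sq {n : ℕ} (η : Fin n → ℝ) (hη : η ∈ pmOne n) (j : Fin n) :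
    ∑ k, dj η j k ^ 2 = (n : ℝ) - 1 := by
  have h : ∀ k, dj η j k ^ 2 = 1 - if k = j then 1 else 0 := by
    intro k
    unfold dj
    by_cases h : k = j
    · simp [h]
    · rcases hη k with h' | h' <;> simp [h, h']
  simp_rw [h]
  rw [Finset.sum_sub_distrib]
  simp

theorem mix_eq {p n : ℕ} (hn : 2 ≤ n) (θ0 : Fin p → ℝ) (τ : ℝ) {σ : ℝ} (hσ : 0 < σ)
    (η : Fin n → ℝ) (hη : η ∈ pmOne n) (j : Fin n) :
    ((G1 p).prod (GW p n)).map (Forig θ0 τ σ η)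
      = ((G1 p).prod ((G1 p).prod (GW p n))).map (Fnew θ0 τ σ η j) := by
  have hmo := measurable_Forig θ0 τ σ η
  have hmn := measurable_Fnew θ0 τ σ η j
  have i1 : IsProbabilityMeasure (((G1 p).prod (GW p n)).map (Forig θ0 τ σ η)) :=
    Measure.isProbabilityMeasure_map hmo.aemeasurable
  have i2 : IsProbabilityMeasure
    (((G1 p).prod ((G1 p).prod (GW p n))).map (Fnew θ0 τ σ η j)) :=
    Measure.isProbabilityMeasure_map hmn.aemeasurable
  apply Measure.ext_of_charFunDual
  ext L
  obtain ⟨c, hc⟩ := dual_expand L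
  rw [charFunDual_apply, charFunDual_apply, integral_map hmo.aemeasurable (by fun_prop),
    integral_map hmn.aemeasurable (by fun_prop)]
  have hηj : η j ^ 2 = 1 := by rcases hη j with h | h <;> rw [h] <;> norm_num
  have hal := alp_mul hn τ hσ
  have hs : Real.sqrt (ssq n τ σ) ^ 2 = ssq n τ σ :=
    Real.sq_sqrt ((sq_nonneg σ).trans (ssq_ge hn τ hσ))
  -- splitting sums at j
  have split : ∀ f : Fin n → ℝ, ∑ k, f k = f j + ∑ k, (if k = j then 0 else f k) := by
    intro f
    have : ∀ k, f k = (if k = j then f k else 0) + (if k = j then 0 else f k) := by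
      intro k; by_cases h : k = j <;> simp [h]
    conv_lhs => rw [Finset.sum_congr rfl (fun k _ => this k)]
    rw [Finset.sum_add_distrib]; simp
  have E1 : ∀ z, Complex.exp (((L (Forig θ0 τ σ η z) : ℝ) : ℂ) * Complex.I) =
     Complex.exp (Complex.I * ((∑ i, ∑ k, c i k * θ0 i * η k
       + ∑ i, (τ * ∑ k, c i k * η k) * z.1 i + ∑ i, ∑ k, (σ * c i k) * z.2 i k : ℝ) : ℂ)) := by
    intro z
    rw [mul_comm, hc]; congr 3
    rw [← Finset.sum_add_distrib, ← Finset.sum_add_distrib]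
    refine Finset.sum_congr rfl fun i _ => ?_
    rw [mul_right_comm, Finset.mul_sum, ← Finset.sum_add_distrib, ← Finset.sum_add_distrib]
    refine Finset.sum_congr rfl fun k _ => ?_
    simp only [Forig]; ring
  have E2 : ∀ z, Complex.exp (((L (Fnew θ0 τ σ η j z) : ℝ) : ℂ) * Complex.I) =
     Complex.exp (Complex.I * ((∑ i, (Real.sqrt (ssq n τ σ) * c i j) * z.1 i +
       (∑ i, ∑ k, c i k * θ0 i * η k
       + ∑ i, (τ * (∑ k, c i k * dj η j k) + c i j * η j * alp n τ σ * ((n:ℝ) - 1) * τ) * z.2.1 i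
       + ∑ i, ∑ k, (σ * ((if k = j then 0 else c i k) + c i j * η j * alp n τ σ * dj η j k))
          * z.2.2 i k) : ℝ) : ℂ)) := by
    intro z
    rw [mul_comm, hc]; congr 3
    rw [← Finset.sum_add_distrib, ← Finset.sum_add_distrib, ← Finset.sum_add_distrib]
    refine Finset.sum_congr rfl fun i _ => ?_
    rw [split, split (fun k => c i k * θ0 i * η k)]
    have : ∑ k, (if k = j then 0 else c i k * Fnew θ0 τ σ η j z i k)
        = ∑ k, (if k = j then 0 else c i k * θ0 i * η k) + τ * (∑ k, c i k * dj η j k) * z.2.1 i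
          + σ * ∑ k, (if k = j then 0 else c i k) * z.2.2 i k := by
      rw [mul_right_comm, Finset.mul_sum, Finset.mul_sum, ← Finset.sum_add_distrib,
        ← Finset.sum_add_distrib]
      refine Finset.sum_congr rfl fun k _ => ?_
      by_cases h : k = j
      · simp [h, dj]
      · simp only [h, if_false, Fnew, dj]; ring
    rw [this]
    have h2 : ∑ k, (σ * ((if k = j then 0 else c i k) + c i j * η j * alp n τ σ * dj η j k))
          * z.2.2 i k = σ * ∑ k, (if k = j then 0 else c i k) * z.2.2 i k
          + c i j * η j * alp n τ σ * σ * ∑ k, dj η j k * z.2.2 i k := by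
      rw [Finset.mul_sum, Finset.mul_sum, ← Finset.sum_add_distrib]
      refine Finset.sum_congr rfl fun k _ => ?_
      ring
    rw [h2]
    simp only [Fnew, if_true, Ufun]
    ring
  simp_rw [E1, E2]
  rw [char2, char3]
  congr 5
  refine Finset.sum_congr rfl fun i _ => ?_
  have s1 : ∑ k, c i k * η k = c i j * η j + ∑ k, c i k * dj η j k := by
    rw [split]; congr 1
    refine Finset.sum_congr rfl fun k _ => ?_
    by_cases h : k = j <;> simp [h, dj]
  have s2 : ∑ k, (σ * c i k) ^ 2
      = σ ^ 2 * c i j ^ 2 + σ ^ 2 * ∑ k, (if k = j then 0 else c i k) ^ 2 := by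
    rw [split, Finset.mul_sum, mul_pow]; congr 1
    refine Finset.sum_congr rfl fun k _ => ?_
    by_cases h : k = j <;> simp [h, mul_pow]
  have s3 : ∑ k, (σ * ((if k = j then 0 else c i k) + c i j * η j * alp n τ σ * dj η j k)) ^ 2
      = σ ^ 2 * ∑ k, (if k = j then 0 else c i k) ^ 2
        + 2 * σ ^ 2 * (c i j * η j * alp n τ σ) * ∑ k, c i k * dj η j k
        + σ ^ 2 * (c i j * η j * alp n τ σ) ^ 2 * ((n : ℝ) - 1) := by
    rw [← sum_dj_sq η hη j, Finset.mul_sum, Finset.mul_sum, Finset.mul_sum,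
      ← Finset.sum_add_distrib, ← Finset.sum_add_distrib]
    refine Finset.sum_congr rfl fun k _ => ?_
    by_cases h : k = j
    · simp [h, dj]
    · simp only [h, if_false]; ring
  rw [s1, s2, s3, mul_pow (Real.sqrt _), hs]
  unfold ssq
  generalize ∑ k, c i k * dj η j k = S
  generalize alp n τ σ = α at *
  generalize (n:ℝ) - 1 = N at *
  generalize c i j = x
  generalize η j = e at *
  linear_combination (-2 * S * x * e - x ^ 2 * α * N * e ^ 2) * hal
    + (τ ^ 2 * x ^ 2 - x ^ 2 * α * N * τ ^ 2) * hηj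


lemma U_law {p n : ℕ} (hn : 2 ≤ n) (τ σ : ℝ) (η : Fin n → ℝ) (hη : η ∈ pmOne n) (j : Fin n)
    (i : Fin p) :
    ((G1 p).prod (GW p n)).map (fun z => Ufun τ σ (dj η j) z i)
      = gaussianReal 0 (((n : ℝ) - 1) * (((n : ℝ) - 1) * τ ^ 2 + σ ^ 2)).toNNReal := by
  have hm : Measurable (fun z : (Fin p → ℝ) × (Fin p → Fin n → ℝ) => Ufun τ σ (dj η j) z i) := by
    unfold Ufun; fun_prop
  have i1 : IsProbabilityMeasure
    (((G1 p).prod (GW p n)).map (fun z => Ufun τ σ (dj η j) z i)) :=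
    Measure.isProbabilityMeasure_map hm.aemeasurable
  have h0 : (2:ℝ) ≤ n := by exact_mod_cast hn
  have hv : 0 ≤ ((n : ℝ) - 1) * (((n : ℝ) - 1) * τ ^ 2 + σ ^ 2) := by
    have : 0 ≤ (n:ℝ) - 1 := by linarith
    positivity
  apply Measure.ext_of_charFun
  ext t
  rw [charFun_gaussianReal, charFun_apply_real, integral_map hm.aemeasurable (by fun_prop)]
  have h := char2 (p := p) (n := n) 0 (fun a => if a = i then t * ((n:ℝ) - 1) * τ else 0)
    (fun a k => if a = i then t * σ * dj η j k else 0)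
  have e : ∀ z : (Fin p → ℝ) × (Fin p → Fin n → ℝ),
     Complex.exp ((t:ℂ) * ((Ufun τ σ (dj η j) z i : ℝ) : ℂ) * Complex.I)
     = Complex.exp (Complex.I * ((0 + ∑ a, (if a = i then t * ((n:ℝ) - 1) * τ else 0) * z.1 a
        + ∑ a, ∑ k, (if a = i then t * σ * dj η j k else 0) * z.2 a k : ℝ) : ℂ)) := by
    intro z
    have e1 : ∑ a, (if a = i then t * ((n:ℝ) - 1) * τ else 0) * z.1 a
        = t * ((n:ℝ) - 1) * τ * z.1 i := by simp
    have e2 : ∑ a, ∑ k, (if a = i then t * σ * dj η j k else 0) * z.2 a k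
        = t * σ * ∑ k, dj η j k * z.2 i k := by
      rw [Finset.sum_eq_single i, Finset.mul_sum]
      · refine Finset.sum_congr rfl fun k _ => ?_
        simp; ring
      · intro b _ hb; simp [hb]
      · simp
    rw [e1, e2]
    congr 1
    unfold Ufun
    push_cast; ring
  simp_rw [e]
  rw [h]
  have e3 : ∑ a : Fin p, ((if a = i then t * ((n:ℝ) - 1) * τ else 0) ^ 2
      + ∑ k, (if a = i then t * σ * dj η j k else 0) ^ 2)
      = t ^ 2 * (((n : ℝ) - 1) * (((n : ℝ) - 1) * τ ^ 2 + σ ^ 2)) := by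
    rw [Finset.sum_eq_single i]
    · simp only [if_true, mul_pow]
      rw [← Finset.mul_sum, sum_dj_sq η hη j]; ring
    · intro b _ hb; simp [hb]
    · simp
  rw [e3, Real.coe_toNNReal _ hv, ← Complex.exp_add]
  congr 1
  push_cast; ring

lemma gauss_quad (v : NNReal) (x a : ℝ) :
    Integrable (fun u => (x + a * u) ^ 2) (gaussianReal 0 v) ∧
    ∫ u, (x + a * u) ^ 2 ∂(gaussianReal 0 v) = x ^ 2 + a ^ 2 * v := by
  have hL2 : MemLp (fun u : ℝ => u) 2 (gaussianReal 0 v) := memLp_id_gaussianReal 2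
  have hi2 : Integrable (fun u : ℝ => u ^ 2) (gaussianReal 0 v) := hL2.integrable_sq
  have hi1 : Integrable (fun u : ℝ => u) (gaussianReal 0 v) := hL2.integrable (by norm_num)
  have hv : ∫ u, u ^ 2 ∂(gaussianReal 0 v) = v := by
    have := variance_fun_id_gaussianReal (μ := 0) (v := v)
    rw [variance_eq_sub hL2] at this
    simpa using this
  have e : ∀ u : ℝ, (x + a * u) ^ 2 = x ^ 2 + 2 * x * a * u + a ^ 2 * u ^ 2 := fun u => by ring
  simp_rw [e]
  have j1 : Integrable (fun u : ℝ => x ^ 2 + 2 * x * a * u) (gaussianReal 0 v) :=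
    (integrable_const _).add (hi1.const_mul _)
  refine ⟨j1.add (hi2.const_mul _), ?_⟩
  rw [integral_add j1 (hi2.const_mul _), integral_add (integrable_const _) (hi1.const_mul _),
    integral_const_mul, integral_const_mul, hv]
  simp

lemma prod_real_symm {α β : Type*} [MeasurableSpace α] [MeasurableSpace β] (μ : Measure α)
    (ν : Measure β) [IsProbabilityMeasure μ] [IsProbabilityMeasure ν] {s : Set (α × β)}
    (hs : MeasurableSet s) :
    Integrable (fun y => μ.real ((fun x => (x, y)) ⁻¹' s)) ν ∧
    (μ.prod ν).real s = ∫ y, μ.real ((fun x => (x, y)) ⁻¹' s) ∂ν := by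
  have hm : Measurable (fun y => μ ((fun x => (x, y)) ⁻¹' s)) := measurable_measure_prodMk_right hs
  constructor
  · refine Integrable.of_bound (C := 1) (hm.ennreal_toReal.aestronglyMeasurable) ?_
    refine Filter.Eventually.of_forall fun y => ?_
    rw [Real.norm_of_nonneg measureReal_nonneg]
    exact measureReal_le_one
  · rw [measureReal_def, Measure.prod_apply_symm hs]
    exact (integral_toReal hm.aemeasurable (Filter.Eventually.of_forall fun y => measure_lt_top _ _)).symm

theorem pair_bound {p n : ℕ} (hn : 2 ≤ n) (θ0 : Fin p → ℝ) (τ : ℝ) {σ : ℝ} (hσ : 0 < σ)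
    (η η' : Fin n → ℝ) (hη : η ∈ pmOne n) (hη' : η' ∈ pmOne n) (j : Fin n)
    (h1 : η j = 1) (h2 : η' j = -1) (h3 : ∀ k, k ≠ j → η k = η' k)
    {t0 : ℝ} (ht0 : 0 < t0)
    (hE : (∑ i, θ0 i ^ 2 + p * (alp n τ σ ^ 2 *
      (((n : ℝ) - 1) * (((n : ℝ) - 1) * τ ^ 2 + σ ^ 2)))) / ssq n τ σ ≤ t0 ^ 2)
    {B : Set (Fin p → Fin n → ℝ)} (hB : MeasurableSet B) :
    2 * Phic t0 ≤ (((G1 p).prod (GW p n)).map (Forig θ0 τ σ η)).real B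
      + (((G1 p).prod (GW p n)).map (Forig θ0 τ σ η')).real Bᶜ := by
  rw [mix_eq hn θ0 τ hσ η hη j, mix_eq hn θ0 τ hσ η' hη' j]
  have hmn := measurable_Fnew θ0 τ σ η j
  have hmn' := measurable_Fnew θ0 τ σ η' j
  have h0 : (2:ℝ) ≤ n := by exact_mod_cast hn
  rw [map_measureReal_apply hmn hB, map_measureReal_apply hmn' hB.compl]
  obtain ⟨I1, e1⟩ := prod_real_symm (G1 p) ((G1 p).prod (GW p n)) (hmn hB)
  obtain ⟨I2, e2⟩ := prod_real_symm (G1 p) ((G1 p).prod (GW p n)) (hmn' hB.compl)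
  rw [e1, e2, ← integral_add I1 I2]
  have hdd : dj η' j = dj η j := by
    ext k; by_cases h : k = j
    · simp [dj, h]
    · simp [dj, h, h3 k h]
  set s := Real.sqrt (ssq n τ σ) with hs
  have hspos : 0 < ssq n τ σ := lt_of_lt_of_le (by positivity) (ssq_ge hn τ hσ)
  have hs0 : 0 < s := Real.sqrt_pos.2 hspos
  have hss : s ^ 2 = ssq n τ σ := Real.sq_sqrt hspos.le
  let m : (Fin p → ℝ) × (Fin p → Fin n → ℝ) → Fin p → ℝ :=
    fun z i => (θ0 i + alp n τ σ * Ufun τ σ (dj η j) z i) / s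
  have hNP : ∀ z, 2 * Phic (Real.sqrt (∑ i, m z i ^ 2)) ≤
      (G1 p).real ((fun x => (x, z)) ⁻¹' (Fnew θ0 τ σ η j ⁻¹' B)) +
      (G1 p).real ((fun x => (x, z)) ⁻¹' (Fnew θ0 τ σ η' j ⁻¹' Bᶜ)) := by
    intro z
    let C : (Fin p → ℝ) → Fin p → Fin n → ℝ := fun x i k => if k = j then s * x i else
      (θ0 i + τ * z.1 i) * η k + σ * z.2 i k
    have hC : Measurable C := by
      refine measurable_pi_lambda _ fun i => measurable_pi_lambda _ fun k => ?_
      by_cases h : k = j <;> simp only [C, h, if_true, if_false] <;> fun_prop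
    have := NP (m z) (hC hB)
    convert this using 3
    · ext x
      simp only [Set.mem_preimage, Set.mem_ofPred_eq]
      have : Fnew θ0 τ σ η j (x, z) = C (fun i => x i + m z i) := by
        ext i k
        by_cases h : k = j
        · simp only [Fnew, C, h, if_true, m, h1]; field_simp; ring
        · simp only [Fnew, C, h, if_false]
      rw [this]
    · ext x
      simp only [Set.mem_preimage, Set.mem_ofPred_eq, Set.mem_compl_iff]
      have : Fnew θ0 τ σ η' j (x, z) = C (fun i => x i - m z i) := by
        ext i k
        by_cases h : k = j
        · simp only [Fnew, C, h, if_true, m, h2, hdd]; field_simp; ring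
        · simp only [Fnew, C, h, if_false, h3 k h]
      rw [this]
  set v : ℝ := ((n : ℝ) - 1) * (((n : ℝ) - 1) * τ ^ 2 + σ ^ 2) with hv
  have hv0 : 0 ≤ v := by
    have : 0 ≤ (n:ℝ) - 1 := by linarith
    positivity
  have hmi : ∀ i, Integrable (fun z => m z i ^ 2) ((G1 p).prod (GW p n)) ∧
      ∫ z, m z i ^ 2 ∂((G1 p).prod (GW p n)) = (θ0 i ^ 2 + alp n τ σ ^ 2 * v) / ssq n τ σ := by
    intro i
    have hmU : Measurable (fun z : (Fin p → ℝ) × (Fin p → Fin n → ℝ) =>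
      Ufun τ σ (dj η j) z i) := by unfold Ufun; fun_prop
    obtain ⟨q1, q2⟩ := gauss_quad v.toNNReal (θ0 i) (alp n τ σ)
    rw [← U_law (p := p) hn τ σ η hη j i] at q1 q2
    rw [integral_map hmU.aemeasurable (by fun_prop)] at q2
    have q1' := (integrable_map_measure (by fun_prop) hmU.aemeasurable).1 q1
    have e : ∀ z, m z i ^ 2 = (θ0 i + alp n τ σ * Ufun τ σ (dj η j) z i) ^ 2 / ssq n τ σ := by
      intro z; simp only [m, div_pow, hss]
    simp_rw [e]
    refine ⟨q1'.div_const _, ?_⟩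
    rw [integral_div, q2, Real.coe_toNNReal _ hv0]
  have hQi : Integrable (fun z => ∑ i, m z i ^ 2) ((G1 p).prod (GW p n)) :=
    integrable_finsetSum _ fun i _ => (hmi i).1
  have hQ : ∫ z, ∑ i, m z i ^ 2 ∂((G1 p).prod (GW p n)) ≤ t0 ^ 2 := by
    rw [integral_finsetSum _ fun i _ => (hmi i).1]
    simp_rw [fun i => (hmi i).2]
    rw [← Finset.sum_div, Finset.sum_add_distrib]
    simpa using hE
  have hlow : ∀ z, 2 * Phic t0 - gaussianPDFReal 0 1 t0 / t0 * (∑ i, m z i ^ 2 - t0 ^ 2) ≤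
      (G1 p).real ((fun x => (x, z)) ⁻¹' (Fnew θ0 τ σ η j ⁻¹' B)) +
      (G1 p).real ((fun x => (x, z)) ⁻¹' (Fnew θ0 τ σ η' j ⁻¹' Bᶜ)) := by
    intro z
    refine le_trans ?_ (hNP z)
    have := Phic_tangent_sq (q := ∑ i, m z i ^ 2)
      (Finset.sum_nonneg (fun _ _ => sq_nonneg _)) ht0
    have e : gaussianPDFReal 0 1 t0 / t0 = 2 * (gaussianPDFReal 0 1 t0 / (2 * t0)) := by field_simp
    rw [e]; linarith
  have hI3 : Integrable (fun z => gaussianPDFReal 0 1 t0 / t0 * (∑ i, m z i ^ 2 - t0 ^ 2))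
    ((G1 p).prod (GW p n)) := (hQi.sub (integrable_const _)).const_mul _
  refine le_trans ?_ (integral_mono ((integrable_const _).sub hI3) (I1.add I2) hlow)
  rw [integral_sub' (integrable_const _) hI3, integral_const_mul (gaussianPDFReal 0 1 t0 / t0), integral_sub hQi (integrable_const _)]
  simp only [integral_const, probReal_univ, smul_eq_mul, one_mul]
  have : 0 ≤ gaussianPDFReal 0 1 t0 / t0 := div_nonneg (gaussianPDFReal_nonneg _ _ _) ht0.le
  nlinarith


/-- label vectors indexed by Booleans, equal to one from `m` on -/
def lab {n : ℕ} (m : ℕ) (b : Fin n → Bool) : Fin n → ℝ :=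
  fun k => if k.val < m ∧ b k = false then -1 else 1

lemma lab_mem {n : ℕ} (m : ℕ) (b : Fin n → Bool) : lab m b ∈ pmOne n := by
  intro k; unfold lab; split_ifs <;> simp

/-- orientation chosen from the known labels -/
def nu {n : ℕ} (m : ℕ) (a : Fin n → ℝ) : ℝ :=
  if 0 ≤ ∑ k : Fin n, (if k.val < m then 0 else a k) then 1 else -1

lemma nu_mul_nonneg {n : ℕ} (m : ℕ) (a : Fin n → ℝ) :
    0 ≤ nu m a * ∑ k : Fin n, (if k.val < m then 0 else a k) := by
  unfold nu; split_ifs with h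
  · linarith
  · push Not at h; linarith

lemma nu_pm {n : ℕ} (m : ℕ) (a : Fin n → ℝ) : nu m a = 1 ∨ nu m a = -1 := by
  unfold nu; split_ifs <;> simp

/-- the first `m` indices -/
def J (n m : ℕ) : Finset (Fin n) := Finset.univ.filter fun k => k.val < m

lemma card_J {n m : ℕ} (h : m ≤ n) : (J n m).card = m := by
  unfold J
  rw [Fin.card_filter_val_lt]; omega

lemma loss_aux1 {n : ℕ} (m : ℕ) {a e : Fin n → ℝ} (ha : a ∈ pmOne n) (he : e ∈ pmOne n)
    (v : ℝ) (hv : v = 1 ∨ v = -1) :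
    ∑ j ∈ J n m, (if v * a j ≠ e j then (1:ℝ) else 0) ≤ ∑ j, |a j - v * e j| := by
  refine le_trans (Finset.sum_le_sum fun j _ => ?_)
    (Finset.sum_le_sum_of_subset_of_nonneg (Finset.subset_univ _) fun j _ _ => abs_nonneg _)
  rcases ha j with h1 | h1 <;> rcases he j with h2 | h2 <;> rcases hv with h3 | h3 <;>
    rw [h1, h2, h3] <;> norm_num

lemma loss_aux2 {n : ℕ} (m : ℕ) (hm : 2 * m ≤ n) {a e : Fin n → ℝ}
    (he1 : ∀ k : Fin n, m ≤ k.val → e k = 1)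
    (v : ℝ) (hv : v = 1 ∨ v = -1) (hv0 : 0 ≤ v * ∑ k : Fin n, (if k.val < m then 0 else a k)) :
    ∑ j ∈ J n m, (if v * a j ≠ e j then (1:ℝ) else 0) ≤ ∑ j, |a j + v * e j| := by
  have h1 : ∑ j ∈ J n m, (if v * a j ≠ e j then (1:ℝ) else 0) ≤ m := by
    refine le_trans (Finset.sum_le_sum (g := fun _ => (1:ℝ)) fun j _ => ?_) ?_
    · split_ifs <;> norm_num
    · simp [card_J (by omega : m ≤ n)]
  have hc : ∑ k : Fin n, (if k.val < m then (0:ℝ) else 1) = n - m := by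
    have e1 : ∀ k : Fin n, (if k.val < m then (0:ℝ) else 1) = 1 - (if k.val < m then 1 else 0) := by
      intro k; split_ifs <;> norm_num
    simp_rw [e1]
    rw [Finset.sum_sub_distrib, Finset.sum_boole]
    have := card_J (by omega : m ≤ n)
    unfold J at this
    rw [this]; simp
  have h2 : v * ∑ k : Fin n, (if k.val < m then 0 else a k)
      + ∑ k : Fin n, (if k.val < m then (0:ℝ) else 1) ≤ ∑ j, |a j + v * e j| := by
    rw [Finset.mul_sum, ← Finset.sum_add_distrib]
    refine Finset.sum_le_sum fun k _ => ?_
    split_ifs with h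
    · simp
    · rw [he1 k (by omega)]
      rcases hv with h | h <;> rw [h]
      · have := le_abs_self (a k + 1 * 1); linarith
      · have := neg_abs_le (a k + -1 * 1); linarith
  have h3 : (2:ℝ) * m ≤ n := by exact_mod_cast hm
  linarith

lemma loss_lower {n : ℕ} (m : ℕ) (hm : 2 * m ≤ n) {a e : Fin n → ℝ} (ha : a ∈ pmOne n)
    (he : e ∈ pmOne n) (he1 : ∀ k : Fin n, m ≤ k.val → e k = 1) :
    ∑ j ∈ J n m, (if nu m a * a j ≠ e j then (1:ℝ) else 0) ≤ lossR a e := by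
  have g1 := loss_aux1 m ha he (nu m a) (nu_pm m a)
  have g2 := loss_aux2 m hm he1 (nu m a) (nu_pm m a) (nu_mul_nonneg m a)
  unfold lossR
  rcases nu_pm m a with h | h <;> rw [h] at g1 g2 ⊢
  · simp only [one_mul] at g1 g2 ⊢
    exact le_min g1 g2
  · simp only [neg_mul, one_mul, sub_neg_eq_add] at g1 g2 ⊢
    exact le_min (by simpa [sub_eq_add_neg] using g2) g1

lemma lossR_nonneg {n : ℕ} (a e : Fin n → ℝ) : 0 ≤ lossR a e :=
  le_min (Finset.sum_nonneg fun _ _ => abs_nonneg _) (Finset.sum_nonneg fun _ _ => abs_nonneg _)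

lemma lossR_le {n : ℕ} {a e : Fin n → ℝ} (ha : a ∈ pmOne n) (he : e ∈ pmOne n) :
    lossR a e ≤ 2 * n := by
  refine (min_le_left _ _).trans ?_
  refine (Finset.sum_le_sum (g := fun _ => (2:ℝ)) fun j _ => ?_).trans ?_
  · rcases ha j with h1 | h1 <;> rcases he j with h2 | h2 <;> rw [h1, h2] <;> norm_num
  · simp [mul_comm]

lemma measurable_nu {n : ℕ} (m : ℕ) : Measurable (nu (n := n) m) := by
  unfold nu
  refine Measurable.ite ?_ measurable_const measurable_const
  refine measurableSet_le measurable_const ?_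
  refine Finset.measurable_sum _ fun k _ => ?_
  split_ifs <;> fun_prop

instance isProb_lawY (p n : ℕ) (σ : ℝ) (θ : Fin p → ℝ) (η : Fin n → ℝ) :
    IsProbabilityMeasure (lawY p n σ θ η) := by unfold lawY; infer_instance

lemma lawY_eq_map (p n : ℕ) (σ : ℝ) (θ : Fin p → ℝ) (η : Fin n → ℝ) :
    lawY p n σ θ η = (GW p n).map (fun ξ i k => θ i * η k + σ * ξ i k) := by
  have h1 : ∀ x : ℝ, (gaussianReal 0 1).map (fun z => x + σ * z) = gaussianReal x (σ ^ 2).toNNReal := by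
    intro x
    have := gaussianReal_map_const_mul (μ := 0) (v := 1) σ
    have h2 : (fun z => x + σ * z) = (fun z => x + z) ∘ (fun z => σ * z) := rfl
    rw [h2, ← Measure.map_map (by fun_prop) (by fun_prop), this, gaussianReal_map_const_add]
    congr 1
    · simp
    · ext; simp [sq_nonneg]
  have h3 : ∀ i, (G1 n).map (fun z k => θ i * η k + σ * z k)
      = Measure.pi fun j => gaussianReal (θ i * η j) (σ ^ 2).toNNReal := by
    intro i
    have : ∀ k, IsProbabilityMeasure ((gaussianReal 0 1).map (fun z => θ i * η k + σ * z)) :=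
      fun k => Measure.isProbabilityMeasure_map (by fun_prop)
    rw [Measure.pi_map_pi (f := fun k z => θ i * η k + σ * z) (fun k => by fun_prop)]
    simp_rw [h1]
  have : ∀ i, IsProbabilityMeasure ((G1 n).map (fun z k => θ i * η k + σ * z k)) :=
      fun k => Measure.isProbabilityMeasure_map (Measurable.aemeasurable (by fun_prop))
  rw [Measure.pi_map_pi (f := fun i (z : Fin n → ℝ) k => θ i * η k + σ * z k) (fun i => Measurable.aemeasurable (by fun_prop))]
  simp_rw [h3]
  rfl

lemma mix_real {p n : ℕ} (θ0 : Fin p → ℝ) (τ σ : ℝ) (η : Fin n → ℝ)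
    {B : Set (Fin p → Fin n → ℝ)} (hB : MeasurableSet B) :
    Integrable (fun g => (lawY p n σ (fun i => θ0 i + τ * g i) η).real B) (G1 p) ∧
    (((G1 p).prod (GW p n)).map (Forig θ0 τ σ η)).real B
      = ∫ g, (lawY p n σ (fun i => θ0 i + τ * g i) η).real B ∂(G1 p) := by
  have hmo := measurable_Forig θ0 τ σ η
  have hm : Measurable (fun g => (GW p n) (Prod.mk g ⁻¹' (Forig θ0 τ σ η ⁻¹' B))) :=
    measurable_measure_prodMk_left (hmo hB)
  have e : ∀ g, (lawY p n σ (fun i => θ0 i + τ * g i) η).real B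
      = ((GW p n) (Prod.mk g ⁻¹' (Forig θ0 τ σ η ⁻¹' B))).toReal := by
    intro g
    rw [lawY_eq_map, measureReal_def, Measure.map_apply (by fun_prop) hB]
    rfl
  constructor
  · refine Integrable.of_bound (C := 1) ?_ ?_
    · simp_rw [e]
      exact hm.ennreal_toReal.aestronglyMeasurable
    refine Filter.Eventually.of_forall fun y => ?_
    rw [Real.norm_of_nonneg measureReal_nonneg]
    exact measureReal_le_one
  · simp_rw [e]
    rw [map_measureReal_apply hmo hB, measureReal_def, Measure.prod_apply (hmo hB)]
    exact (integral_toReal hm.aemeasurable (Filter.Eventually.of_forall fun y => measure_lt_top _ _)).symm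

lemma risk_nonneg {p n : ℕ} (σ : ℝ) (f : (Fin p → Fin n → ℝ) → Fin n → ℝ)
    (θ : Fin p → ℝ) (η : Fin n → ℝ) : 0 ≤ risk p n σ f θ η :=
  integral_nonneg fun _ => lossR_nonneg _ _

lemma integrable_loss {p n : ℕ} (σ : ℝ) {f : (Fin p → Fin n → ℝ) → Fin n → ℝ} (hf : Measurable f)
    (hf1 : ∀ y, f y ∈ pmOne n) (θ : Fin p → ℝ) {η : Fin n → ℝ} (hη : η ∈ pmOne n) :
    Integrable (fun y => lossR (f y) η) (lawY p n σ θ η) := by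
  refine Integrable.of_bound (C := 2 * n) ?_ ?_
  · refine Measurable.aestronglyMeasurable ?_
    unfold lossR
    have : ∀ j, Measurable (fun y => f y j) := fun j => (measurable_pi_apply j).comp hf
    refine Measurable.min ?_ ?_ <;> refine Finset.measurable_sum _ fun j _ => ?_
    · exact ((this j).sub_const _).abs
    · exact ((this j).add_const _).abs
  · refine Filter.Eventually.of_forall fun y => ?_
    rw [Real.norm_of_nonneg (lossR_nonneg _ _)]
    exact lossR_le (hf1 y) hη

lemma risk_le {p n : ℕ} (σ : ℝ) {f : (Fin p → Fin n → ℝ) → Fin n → ℝ} (hf : Measurable f)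
    (hf1 : ∀ y, f y ∈ pmOne n) (θ : Fin p → ℝ) {η : Fin n → ℝ} (hη : η ∈ pmOne n) :
    risk p n σ f θ η ≤ 2 * n := by
  unfold risk
  refine (integral_mono (integrable_loss σ hf hf1 θ hη) (integrable_const (2 * (n:ℝ)))
    fun y => lossR_le (hf1 y) hη).trans ?_
  simp

/-- disagreement set -/
def Bset {p n : ℕ} (m : ℕ) (f : (Fin p → Fin n → ℝ) → Fin n → ℝ) (j : Fin n) (s : ℝ) :
    Set (Fin p → Fin n → ℝ) := {y | nu m (f y) * f y j ≠ s}

lemma measurable_Bset {p n : ℕ} (m : ℕ) {f : (Fin p → Fin n → ℝ) → Fin n → ℝ} (hf : Measurable f)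
    (j : Fin n) (s : ℝ) : MeasurableSet (Bset m f j s) := by
  have h1 : Measurable fun y => nu m (f y) * f y j :=
    ((measurable_nu m).comp hf).mul ((measurable_pi_apply j).comp hf)
  exact (h1 (measurableSet_singleton s)).compl

lemma risk_lower {p n : ℕ} (m : ℕ) (hm : 2 * m ≤ n) (σ : ℝ) {f : (Fin p → Fin n → ℝ) → Fin n → ℝ}
    (hf : Measurable f) (hf1 : ∀ y, f y ∈ pmOne n) (θ : Fin p → ℝ) {η : Fin n → ℝ}
    (hη : η ∈ pmOne n) (he1 : ∀ k : Fin n, m ≤ k.val → η k = 1) :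
    ∑ j ∈ J n m, (lawY p n σ θ η).real (Bset m f j (η j)) ≤ risk p n σ f θ η := by
  have hI : ∀ j, Integrable ((Bset m f j (η j)).indicator (fun _ => (1:ℝ))) (lawY p n σ θ η) :=
    fun j => (integrable_const _).indicator (measurable_Bset m hf j _)
  have e : ∑ j ∈ J n m, (lawY p n σ θ η).real (Bset m f j (η j))
      = ∫ y, ∑ j ∈ J n m, (Bset m f j (η j)).indicator (fun _ => (1:ℝ)) y ∂(lawY p n σ θ η) := by
    rw [integral_finsetSum _ fun j _ => hI j]
    refine Finset.sum_congr rfl fun j _ => ?_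
    rw [integral_indicator_const _ (measurable_Bset m hf j _)]; simp
  rw [e]
  refine integral_mono (integrable_finsetSum _ fun j _ => hI j) (integrable_loss σ hf hf1 θ hη) ?_
  intro y
  refine le_trans (le_of_eq ?_) (loss_lower m hm (hf1 y) hη he1)
  refine Finset.sum_congr rfl fun j _ => ?_
  by_cases h : nu m (f y) * f y j ≠ η j
  · rw [if_pos h, Set.indicator_of_mem (by exact h)]
  · rw [if_neg h, Set.indicator_of_notMem (by exact h)]

theorem core {p n : ℕ} (hn : 2 ≤ n) (θ0 : Fin p → ℝ) (τ Δ : ℝ) {σ : ℝ} (hσ : 0 < σ)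
    {t0 : ℝ} (ht0 : 0 < t0)
    (hE : (∑ i, θ0 i ^ 2 + p * (alp n τ σ ^ 2 *
      (((n : ℝ) - 1) * (((n : ℝ) - 1) * τ ^ 2 + σ ^ 2)))) / ssq n τ σ ≤ t0 ^ 2) :
    Phic t0 / 3 - (G1 p).real {g | eucNorm (fun i => θ0 i + τ * g i) < Δ} ≤ minimaxRisk p n σ Δ := by
  unfold _root_.minimaxRisk
  have hne : Nonempty {f : (Fin p → Fin n → ℝ) → Fin n → ℝ // Measurable f ∧ ∀ y, f y ∈ pmOne n} :=
    ⟨⟨fun _ _ => 1, measurable_const, fun y i => Or.inl rfl⟩⟩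
  refine le_ciInf ?_
  rintro ⟨f, hf, hf1⟩
  simp only
  have hn0 : (0:ℝ) < n := by have : 0 < n := by omega
                             exact_mod_cast this
  set S := ⨆ x : Omega p n Δ, (n : ℝ)⁻¹ * risk p n σ f x.1.1 x.1.2 with hS
  have hbdd : BddAbove (Set.range fun x : Omega p n Δ => (n : ℝ)⁻¹ * risk p n σ f x.1.1 x.1.2) := by
    refine ⟨2, ?_⟩
    rintro _ ⟨x, rfl⟩
    have := risk_le σ hf hf1 x.1.1 x.2.2
    simp only
    rw [inv_mul_le_iff₀ hn0]; linarith
  have hS0 : 0 ≤ S := Real.iSup_nonneg fun x => mul_nonneg (by positivity) (risk_nonneg _ _ _ _)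
  let m := n / 2
  have hm : 2 * m ≤ n := by omega
  have hm3 : (n:ℝ) ≤ 3 * m := by have : n ≤ 3 * m := by omega
                                 exact_mod_cast this
  set bad := {g : Fin p → ℝ | eucNorm (fun i => θ0 i + τ * g i) < Δ} with hbad
  have hbadm : MeasurableSet bad := by
    refine measurableSet_lt ?_ measurable_const
    unfold eucNorm; fun_prop
  have hlab1 : ∀ (b : Fin n → Bool) (k : Fin n), m ≤ k.val → lab m b k = 1 := by
    intro b k hk; unfold lab; rw [if_neg]; omega
  let M : (Fin n → Bool) → Measure (Fin p → Fin n → ℝ) :=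
    fun b => ((G1 p).prod (GW p n)).map (Forig θ0 τ σ (lab m b))
  have step1 : ∀ b, ∑ j ∈ J n m, (M b).real (Bset m f j (lab m b j)) ≤ n * S + n * (G1 p).real bad := by
    intro b
    have e : ∑ j ∈ J n m, (M b).real (Bset m f j (lab m b j))
        = ∫ g, ∑ j ∈ J n m, (lawY p n σ (fun i => θ0 i + τ * g i) (lab m b)).real
          (Bset m f j (lab m b j)) ∂(G1 p) := by
      rw [integral_finsetSum _ fun j _ => (mix_real θ0 τ σ (lab m b) (measurable_Bset m hf j _)).1]
      exact Finset.sum_congr rfl fun j _ => (mix_real θ0 τ σ (lab m b) (measurable_Bset m hf j _)).2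
    have e2 : (n * S + n * (G1 p).real bad : ℝ)
        = ∫ g, ((n:ℝ) * S + bad.indicator (fun _ => (n:ℝ)) g) ∂(G1 p) := by
      rw [integral_add (integrable_const _) ((integrable_const _).indicator hbadm),
        integral_indicator_const _ hbadm]
      simp [mul_comm]
    rw [e, e2]
    refine integral_mono (integrable_finsetSum _ fun j _ =>
      (mix_real θ0 τ σ (lab m b) (measurable_Bset m hf j _)).1)
      ((integrable_const _).add ((integrable_const _).indicator hbadm)) ?_
    intro g
    simp only
    by_cases hg : g ∈ bad
    · rw [Set.indicator_of_mem hg]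
      have h1 : ∑ j ∈ J n m, (lawY p n σ (fun i => θ0 i + τ * g i) (lab m b)).real
          (Bset m f j (lab m b j)) ≤ n := by
        refine (Finset.sum_le_sum (g := fun _ => (1:ℝ)) fun j _ => measureReal_le_one).trans ?_
        simp only [Finset.sum_const, nsmul_eq_mul, mul_one]
        rw [card_J (by omega)]
        have : m ≤ n := by omega
        exact_mod_cast this
      have := mul_nonneg hn0.le hS0
      linarith
    · rw [Set.indicator_of_notMem hg, add_zero]
      refine (risk_lower m hm σ hf hf1 _ (lab_mem m b) (hlab1 b)).trans ?_
      have hg' : Δ ≤ eucNorm (fun i => θ0 i + τ * g i) := not_lt.1 hg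
      have := le_ciSup hbdd ⟨(fun i => θ0 i + τ * g i, lab m b), hg', lab_mem m b⟩
      rw [inv_mul_le_iff₀ hn0] at this
      exact this
  have step2 : ∀ j ∈ J n m, (Fintype.card (Fin n → Bool) : ℝ) * Phic t0
      ≤ ∑ b, (M b).real (Bset m f j (lab m b j)) := by
    intro j hj
    have hjm : j.val < m := by simpa [J] using hj
    let fl : (Fin n → Bool) → (Fin n → Bool) := fun b => Function.update b j (!b j)
    have hfl : Function.Involutive fl := by
      intro b; simp [fl]
    have hpm : ∀ y, nu m (f y) * f y j = 1 ∨ nu m (f y) * f y j = -1 := by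
      intro y
      rcases nu_pm m (f y) with h | h <;> rcases hf1 y j with h' | h' <;> rw [h, h'] <;> norm_num
    have hcompl : Bset m f j (-1) = (Bset m f j 1)ᶜ := by
      ext y
      simp only [Bset, Set.mem_compl_iff, Set.mem_ofPred_eq]
      rcases hpm y with h | h <;> rw [h] <;> norm_num
    have base : ∀ b : Fin n → Bool, b j = true → 2 * Phic t0 ≤
        (M b).real (Bset m f j (lab m b j)) + (M (fl b)).real (Bset m f j (lab m (fl b) j)) := by
      intro b hb
      have l1 : lab m b j = 1 := by simp [lab, hb]
      have l2 : lab m (fl b) j = -1 := by simp [lab, fl, hb, hjm]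
      rw [l1, l2, hcompl]
      refine pair_bound hn θ0 τ hσ (lab m b) (lab m (fl b)) (lab_mem _ _) (lab_mem _ _) j l1 l2 ?_
        ht0 hE (measurable_Bset m hf j 1)
      intro k hk
      simp [lab, fl, hk]
    have hpair : ∀ b : Fin n → Bool, 2 * Phic t0 ≤
        (M b).real (Bset m f j (lab m b j)) + (M (fl b)).real (Bset m f j (lab m (fl b) j)) := by
      intro b
      cases hb : b j with
      | true => exact base b hb
      | false =>
        have := base (fl b) (by simp [fl, hb])
        rw [hfl b] at this
        linarith
    have hsum : ∑ b, (M (fl b)).real (Bset m f j (lab m (fl b) j))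
        = ∑ b, (M b).real (Bset m f j (lab m b j)) :=
      Equiv.sum_comp (hfl.toPerm fl) (fun b => (M b).real (Bset m f j (lab m b j)))
    have := Finset.sum_le_sum fun b (_ : b ∈ (Finset.univ : Finset (Fin n → Bool))) => hpair b
    rw [Finset.sum_add_distrib, hsum, Finset.sum_const, nsmul_eq_mul, Finset.card_univ] at this
    linarith
  have step3 := Finset.sum_le_sum fun b (_ : b ∈ (Finset.univ : Finset (Fin n → Bool))) => step1 b
  rw [Finset.sum_comm, Finset.sum_const, nsmul_eq_mul, Finset.card_univ] at step3
  have step4 := (Finset.sum_le_sum step2).trans step3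
  rw [Finset.sum_const, nsmul_eq_mul, card_J (by omega : m ≤ n)] at step4
  have hc : (0:ℝ) < Fintype.card (Fin n → Bool) := by exact_mod_cast Fintype.card_pos
  have step5 : (m:ℝ) * Phic t0 ≤ n * S + n * (G1 p).real bad := by
    refine le_of_mul_le_mul_left ?_ hc
    linarith
  have hP := Phic_nonneg t0
  have step6 : (n:ℝ) * (Phic t0 / 3) ≤ n * (S + (G1 p).real bad) := by nlinarith
  have := le_of_mul_le_mul_left step6 hn0
  linarith


lemma gauss_exp {l : ℝ} (hl : 0 < l) :
    ∫ x, Real.exp (-l * x ^ 2) ∂(gaussianReal 0 1) ≤ Real.exp (-(l / (1 + 2 * l))) := by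
  have h1 : ∫ x, Real.exp (-l * x ^ 2) ∂(gaussianReal 0 1)
      = (Real.sqrt (2 * Real.pi))⁻¹ * Real.sqrt (Real.pi / (1 / 2 + l)) := by
    rw [integral_gaussianReal_eq_integral_smul one_ne_zero, ← integral_gaussian,
      ← integral_const_mul]
    refine integral_congr_ae (Filter.Eventually.of_forall fun x => ?_)
    simp only [gaussianPDFReal, smul_eq_mul, NNReal.coe_one, mul_one, sub_zero]
    rw [mul_assoc, ← Real.exp_add]
    congr 2; ring
  rw [h1]
  refine le_of_sq_le_sq ?_ (Real.exp_pos _).le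
  rw [mul_pow, inv_pow, Real.sq_sqrt (by positivity), Real.sq_sqrt (by positivity),
    ← Real.exp_nat_mul]
  have h2 := Real.add_one_le_exp (-(2 * l / (1 + 2 * l)))
  have h3 : (2 * Real.pi)⁻¹ * (Real.pi / (1 / 2 + l)) = -(2 * l / (1 + 2 * l)) + 1 := by
    have := Real.pi_pos
    field_simp; ring
  rw [h3]
  refine h2.trans (le_of_eq ?_)
  congr 1; push_cast; ring

/-- exponent in the chi-square lower deviation bound -/
def cdel (δ : ℝ) : ℝ := δ / 4 * (1 / (1 + δ / 2) - 1 / (1 + δ))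

lemma cdel_pos {δ : ℝ} (hδ : 0 < δ) : 0 < cdel δ := by
  unfold cdel
  have : 1 / (1 + δ) < 1 / (1 + δ / 2) := one_div_lt_one_div_of_lt (by positivity) (by linarith)
  have : 0 < 1 / (1 + δ / 2) - 1 / (1 + δ) := by linarith
  positivity

lemma chi_lower (p : ℕ) {δ : ℝ} (hδ : 0 < δ) :
    (G1 p).real {g | ∑ i, g i ^ 2 < p / (1 + δ)} ≤ Real.exp (-(cdel δ * p)) := by
  have hms : MeasurableSet {g : Fin p → ℝ | ∑ i, g i ^ 2 < p / (1 + δ)} :=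
    measurableSet_lt (by fun_prop) measurable_const
  set A := {g : Fin p → ℝ | ∑ i, g i ^ 2 < p / (1 + δ)} with hA
  have e1 : (G1 p).real A = ∫ g, A.indicator (fun _ => (1:ℝ)) g ∂(G1 p) := by
    rw [integral_indicator_const _ hms]; simp
  have e2 : ∀ g : Fin p → ℝ, Real.exp (δ / 4 * (p / (1 + δ))) * ∏ i, Real.exp (-(δ / 4) * g i ^ 2)
      = Real.exp (δ / 4 * (p / (1 + δ) - ∑ i, g i ^ 2)) := by
    intro g
    rw [← Real.exp_sum, ← Real.exp_add, ← Finset.mul_sum]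
    congr 1; ring
  have hIntg : Integrable (fun g : Fin p → ℝ =>
      Real.exp (δ / 4 * (p / (1 + δ))) * ∏ i, Real.exp (-(δ / 4) * g i ^ 2)) (G1 p) := by
    refine Integrable.of_bound (C := Real.exp (δ / 4 * (p / (1 + δ))))
      (Measurable.aestronglyMeasurable (by fun_prop)) ?_
    refine Filter.Eventually.of_forall fun g => ?_
    rw [e2, Real.norm_of_nonneg (Real.exp_pos _).le, Real.exp_le_exp]
    have : 0 ≤ ∑ i, g i ^ 2 := Finset.sum_nonneg fun _ _ => sq_nonneg _
    gcongr
    linarith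
  rw [e1]
  refine (integral_mono ((integrable_const _).indicator hms) hIntg ?_).trans ?_
  · intro g
    simp only [e2]
    by_cases hg : g ∈ A
    · rw [Set.indicator_of_mem hg]
      have hg' : ∑ i, g i ^ 2 < p / (1 + δ) := hg
      apply Real.one_le_exp
      have : 0 ≤ p / (1 + δ) - ∑ i, g i ^ 2 := by linarith
      positivity
    · rw [Set.indicator_of_notMem hg]; positivity
  · rw [integral_const_mul, integral_fintype_prod_eq_pow (fun x : ℝ => Real.exp (-(δ / 4) * x ^ 2)),
      Fintype.card_fin]
    have h0 : 0 ≤ ∫ x, Real.exp (-(δ / 4) * x ^ 2) ∂(gaussianReal 0 1) :=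
      integral_nonneg fun x => (Real.exp_pos _).le
    have h := pow_le_pow_left₀ h0 (gauss_exp (by positivity : 0 < δ / 4)) p
    refine (mul_le_mul_of_nonneg_left h (Real.exp_pos _).le).trans (le_of_eq ?_)
    rw [← Real.exp_nat_mul, ← Real.exp_add]
    congr 1
    unfold cdel
    have : 1 + 2 * (δ / 4) = 1 + δ / 2 := by ring
    rw [this]; ring

lemma known_theta {p n : ℕ} (hn : 2 ≤ n) (hp : 1 ≤ p) {σ Δ : ℝ} (hσ : 0 < σ) (hΔ : 0 < Δ) :
    Phic (Real.sqrt (Δ ^ 2 / σ ^ 2)) / 3 ≤ minimaxRisk p n σ Δ := by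
  have hs : ∑ i, (Pi.single (⟨0, by omega⟩ : Fin p) Δ : Fin p → ℝ) i ^ 2 = Δ ^ 2 := by
    rw [Finset.sum_eq_single (⟨0, by omega⟩ : Fin p)]
    · simp
    · intro b _ hb; simp [Pi.single_eq_of_ne hb]
    · simp
  have h := core (p := p) hn (Pi.single ⟨0, by omega⟩ Δ) 0 Δ hσ
    (t0 := Real.sqrt (Δ ^ 2 / σ ^ 2)) (by positivity) (by
      rw [hs, Real.sq_sqrt (by positivity)]; simp [alp, ssq])
  have he : {g : Fin p → ℝ | eucNorm (fun i => (Pi.single (⟨0, by omega⟩ : Fin p) Δ : Fin p → ℝ) i + 0 * g i) < Δ} = ∅ := by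
    ext g
    simp only [eucNorm, zero_mul, add_zero, hs, Real.sqrt_sq hΔ.le, Set.mem_ofPred_eq, lt_irrefl]
    simp
  rw [he] at h
  simpa using h

lemma snr_pos {p n : ℕ} {σ Δ : ℝ} (hσ : 0 < σ) (hΔ : 0 < Δ) : 0 < snr p n σ Δ := by
  unfold snr; positivity

lemma snr_sq {p n : ℕ} {σ Δ : ℝ} (hσ : 0 < σ) (hΔ : 0 < Δ) :
    snr p n σ Δ ^ 2 = (Δ ^ 2 / σ ^ 2) ^ 2 / (Δ ^ 2 / σ ^ 2 + (p : ℝ) / n) := by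
  unfold snr; rw [div_pow, Real.sq_sqrt (by positivity)]

lemma bayes_theta {p n : ℕ} (hn : 2 ≤ n) (hp : 1 ≤ p) {σ Δ δ : ℝ} (hσ : 0 < σ) (hΔ : 0 < Δ)
    (hδ : 0 < δ) :
    Phic (snr p n σ Δ * (1 + δ)) / 3 - Real.exp (-(cdel δ * p)) ≤ minimaxRisk p n σ Δ := by
  have hn0 : (2:ℝ) ≤ n := by exact_mod_cast hn
  have hp0 : (1:ℝ) ≤ p := by exact_mod_cast hp
  have hr := snr_pos (p := p) (n := n) hσ hΔ
  set τ := Real.sqrt ((1 + δ) * Δ ^ 2 / p) with hτ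
  have hτ2 : τ ^ 2 = (1 + δ) * Δ ^ 2 / p := Real.sq_sqrt (by positivity)
  have h := core (p := p) hn (fun _ => 0) τ Δ hσ (t0 := snr p n σ Δ * (1 + δ)) (by positivity) (by
    have hv : 0 < ((n : ℝ) - 1) * τ ^ 2 + σ ^ 2 := by
      have : 0 ≤ ((n : ℝ) - 1) * τ ^ 2 := mul_nonneg (by linarith) (sq_nonneg _)
      positivity
    have hn1 : 0 < (n:ℝ) - 1 := by linarith
    have e1 : alp n τ σ ^ 2 * (((n : ℝ) - 1) * (((n : ℝ) - 1) * τ ^ 2 + σ ^ 2))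
        = τ ^ 4 * ((n:ℝ) - 1) / (((n : ℝ) - 1) * τ ^ 2 + σ ^ 2) := by
      unfold alp; field_simp
    have hs := ssq_ge hn τ hσ
    have hs0 : 0 < ssq n τ σ := lt_of_lt_of_le (by positivity) hs
    rw [e1, mul_pow, snr_sq hσ hΔ]
    simp only [ne_eq, OfNat.ofNat_ne_zero, not_false_eq_true, zero_pow, Finset.sum_const_zero, zero_add]
    have hτp : 0 < τ ^ 2 := by rw [hτ2]; positivity
    have s1 : p * (τ ^ 4 * ((n:ℝ) - 1) / (((n : ℝ) - 1) * τ ^ 2 + σ ^ 2)) / ssq n τ σ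
        ≤ p * (τ ^ 4 * ((n:ℝ) - 1) / (((n : ℝ) - 1) * τ ^ 2 + σ ^ 2)) / σ ^ 2 := by
      have : 0 ≤ p * (τ ^ 4 * ((n:ℝ) - 1) / (((n : ℝ) - 1) * τ ^ 2 + σ ^ 2)) := by positivity
      gcongr
    have s2 : τ ^ 4 * ((n:ℝ) - 1) / (((n : ℝ) - 1) * τ ^ 2 + σ ^ 2) ≤ τ ^ 4 * n / (n * τ ^ 2 + σ ^ 2) := by
      rw [div_le_div_iff₀ hv (by positivity)]
      have : 0 ≤ τ ^ 4 * σ ^ 2 := by positivity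
      nlinarith
    have s3 : p * (τ ^ 4 * n / (n * τ ^ 2 + σ ^ 2)) / σ ^ 2
        = (Δ ^ 2 / σ ^ 2) ^ 2 * (1 + δ) ^ 2 / ((1 + δ) * (Δ ^ 2 / σ ^ 2) + (p : ℝ) / n) := by
      have : τ ^ 4 = (τ ^ 2) ^ 2 := by ring
      rw [this, hτ2]
      field_simp
    refine s1.trans ?_
    refine (div_le_div_of_nonneg_right (mul_le_mul_of_nonneg_left s2 (by positivity)) (by positivity)).trans ?_
    rw [s3, div_mul_eq_mul_div]
    have : 0 ≤ δ * (Δ ^ 2 / σ ^ 2) := by positivity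
    gcongr
    linarith)
  have hsub : (G1 p).real {g | eucNorm (fun i => (0:ℝ) + τ * g i) < Δ}
      ≤ (G1 p).real {g | ∑ i, g i ^ 2 < p / (1 + δ)} := by
    refine measureReal_mono ?_
    intro g hg
    have hg' : eucNorm (fun i => (0:ℝ) + τ * g i) < Δ := hg
    unfold eucNorm at hg'
    rw [Real.sqrt_lt' hΔ] at hg'
    simp only [zero_add, mul_pow, ← Finset.mul_sum] at hg'
    show ∑ i, g i ^ 2 < p / (1 + δ)
    rw [hτ2] at hg'
    rw [lt_div_iff₀ (by positivity)]
    have h2 : (1 + δ) * Δ ^ 2 / p * ∑ i, g i ^ 2 = Δ ^ 2 * ((∑ i, g i ^ 2) * (1 + δ) / p) := by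
      field_simp
    rw [h2] at hg'
    have h3 : (∑ i, g i ^ 2) * (1 + δ) / p < 1 := by
      by_contra hc
      push Not at hc
      have := mul_le_mul_of_nonneg_left hc (sq_nonneg Δ)
      linarith
    rwa [div_lt_one (by positivity)] at h3
  have := chi_lower p hδ
  linarith

/-- the absolute constant -/
def cst : ℝ := min (1 / 6) (Phic 1 / 3)

lemma main_lemma {δ : ℝ} (hδ : 0 < δ) (hδ1 : δ ≤ 1) :
    ∃ N : ℕ, ∀ n ≥ N, ∀ (p : ℕ) (σ Δ : ℝ), 1 ≤ p → 0 < σ → 0 < Δ →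
      cst * Phic (snr p n σ Δ * (1 + δ)) ≤ minimaxRisk p n σ Δ := by
  have hc := cdel_pos hδ
  set K := (Real.sqrt (2 * Real.pi))⁻¹ * Real.exp (-1) with hK
  have hK0 : 0 < K := by positivity
  have t1 : Tendsto (fun n : ℕ => Real.exp (-(cdel δ * δ / 2 * n))) atTop (nhds 0) := by
    refine Real.tendsto_exp_neg_atTop_nhds_zero.comp ?_
    exact (tendsto_natCast_atTop_atTop (R := ℝ)).const_mul_atTop (by positivity)
  have ev1 := t1.eventually (eventually_le_nhds (by positivity : 0 < K / 6))
  have ev2 := (tendsto_natCast_atTop_atTop (R := ℝ)).eventually_ge_atTop (8 / (δ ^ 2 * cdel δ))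
  obtain ⟨N, hN⟩ := Filter.eventually_atTop.1 (ev1.and (ev2.and (Filter.eventually_ge_atTop 2)))
  refine ⟨N, fun n hn p σ Δ hp hσ hΔ => ?_⟩
  obtain ⟨q1, q2, hn2⟩ := hN n hn
  have hn0 : (2:ℝ) ≤ n := by exact_mod_cast hn2
  have hp0 : (1:ℝ) ≤ p := by exact_mod_cast hp
  have hr := snr_pos (p := p) (n := n) hσ hΔ
  have hr2 := snr_sq (p := p) (n := n) hσ hΔ
  have hkt := known_theta hn2 hp hσ hΔ
  have hbt := bayes_theta hn2 hp hσ hΔ hδ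
  have ha : 0 < Δ ^ 2 / σ ^ 2 := by positivity
  generalize Δ ^ 2 / σ ^ 2 = a at *
  generalize snr p n σ Δ = r at *
  generalize _root_.minimaxRisk p n σ Δ = Ψ at *
  have c1 : cst ≤ 1 / 6 := min_le_left _ _
  have c2 : cst ≤ Phic 1 / 3 := min_le_right _ _
  have hP := Phic_nonneg (r * (1 + δ))
  have hP1 := Phic_le_one (r * (1 + δ))
  rcases le_or_gt a 1 with h1 | h1
  · have : Phic 1 ≤ Phic (Real.sqrt a) := Phic_anti (Real.sqrt_le_one.2 h1)
    have := Phic_nonneg 1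
    nlinarith
  rcases le_or_gt ((p:ℝ) / n) (δ * a) with h2 | h2
  · have : Phic (r * (1 + δ)) ≤ Phic (Real.sqrt a) := by
      refine Phic_anti ?_
      refine Real.sqrt_le_iff.2 ⟨by positivity, ?_⟩
      rw [mul_pow, hr2, div_mul_eq_mul_div, le_div_iff₀ (by positivity)]
      have : a * (a + p / n) ≤ a * ((1 + δ) * a) := by gcongr; linarith
      have : 0 ≤ a ^ 2 * (δ * (1 + δ)) := by positivity
      nlinarith
    nlinarith
  · have hpn : δ * n < p := by
      have : δ * 1 < p / n := lt_of_le_of_lt (by gcongr) h2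
      rw [lt_div_iff₀ (by linarith)] at this
      linarith
    have hrr : (r * (1 + δ)) ^ 2 ≤ cdel δ / 2 * p := by
      have g1 : r ^ 2 ≤ (p / n) / δ ^ 2 := by
        rw [hr2]
        rw [div_le_div_iff₀ (by positivity) (by positivity)]
        have : (δ * a) ^ 2 ≤ (p / n) ^ 2 := by gcongr
        have : 0 ≤ p / n * a := by positivity
        nlinarith
      have g2 : (1 + δ) ^ 2 ≤ 4 := by nlinarith
      have g3 : (r * (1 + δ)) ^ 2 ≤ (p / n) / δ ^ 2 * 4 := by
        rw [mul_pow]; gcongr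
      refine g3.trans ?_
      rw [div_le_iff₀ (by positivity)] at q2
      rw [div_div, div_mul_eq_mul_div, div_le_iff₀ (by positivity)]
      have := mul_le_mul_of_nonneg_left q2 (by positivity : (0:ℝ) ≤ p / 2)
      nlinarith
    have hl := Phic_lower (t := r * (1 + δ)) (by positivity)
    have b1 : Real.exp (-(cdel δ * p)) ≤ K / 6 * Real.exp (-(r * (1 + δ)) ^ 2) := by
      have : Real.exp (-(cdel δ * p)) ≤ Real.exp (-(cdel δ * δ / 2 * n)) * Real.exp (-(r * (1 + δ)) ^ 2) := by
        rw [← Real.exp_add, Real.exp_le_exp]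
        have := mul_le_mul_of_nonneg_left hpn.le (by positivity : 0 ≤ cdel δ / 2)
        have e : -(r * (1 + δ)) ^ 2 = -((r * (1 + δ)) ^ 2) := rfl
        rw [e]
        linarith
      refine this.trans ?_
      gcongr
    rw [← hK] at hl
    nlinarith

lemma cst_pos : 0 < cst := lt_min (by norm_num) (div_pos (Phic_pos 1) (by norm_num))

/-- Theorem 2: `Ψ_{Δ_n} ≥ c Φᶜ(r_n (1 + ε_n))` for large `n`, with `ε_n → 0`. -/
theorem statement4 :
    ∃ c : ℝ, 0 < c ∧ ∀ (p : ℕ → ℕ) (σ Δ : ℕ → ℝ),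
      (∀ n, 1 ≤ p n) → (∀ n, 0 < σ n) → (∀ n, 0 < Δ n) →
      ∃ ε : ℕ → ℝ, Tendsto ε atTop (nhds 0) ∧ ∃ N : ℕ, ∀ n ≥ N,
        c * Phic (snr (p n) n (σ n) (Δ n) * (1 + ε n))
          ≤ minimaxRisk (p n) n (σ n) (Δ n) := by
  refine ⟨cst, cst_pos, fun p σ Δ hp hσ hΔ => ?_⟩
  have hex : ∀ k : ℕ, ∃ N : ℕ, ∀ n ≥ N, ∀ (p : ℕ) (σ Δ : ℝ), 1 ≤ p → 0 < σ → 0 < Δ →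
      cst * Phic (snr p n σ Δ * (1 + 1 / ((k:ℝ) + 1))) ≤ minimaxRisk p n σ Δ := by
    intro k
    refine main_lemma (by positivity) ?_
    rw [div_le_one (by positivity)]
    have : (0:ℝ) ≤ k := Nat.cast_nonneg k
    linarith
  choose N hN using hex
  let k : ℕ → ℕ := fun n => Nat.findGreatest (fun k => N k ≤ n) n
  refine ⟨fun n => 1 / ((k n : ℝ) + 1), ?_, N 0, fun n hn => ?_⟩
  · have hk : Tendsto k atTop atTop := by
      refine tendsto_atTop.2 fun b => ?_
      filter_upwards [Filter.eventually_ge_atTop (max b (N b))] with n hn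
      exact Nat.le_findGreatest ((le_max_left _ _).trans hn) ((le_max_right _ _).trans hn)
    exact tendsto_one_div_add_atTop_nhds_zero_nat.comp hk
  · have : N (k n) ≤ n := Nat.findGreatest_spec (P := fun k => N k ≤ n) (Nat.zero_le n) hn
    exact hN (k n) n this (p n) (σ n) (Δ n) (hp n) (hσ n) (hΔ n)


end
end
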